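/- Suppose the meromorphic mapping Φ = (φ₁,…,φ_n) admits an algebraic addition theorem. Then for each j ∈ {1,…,n}, if φ_j is not rational, then φ_j is periodic: there exists p ∈ ℂⁿ with p ≠ 0 such that φ_j(u + p) = φ_j(u) for every u at which both sides are analytic. -/

import Mathlib

open MvPolynomial

/-- The partial derivative `∂f/∂u_p` of a function on ℂⁿ. -/
noncomputable def pd {n : ℕ} (f : (Fin n → ℂ) → ℂ) (p : Fin n) (u : Fin n → ℂ) : ℂ :=
  fderiv ℂ f u (Pi.single p 1)

/-- `f` is meromorphic on ℂⁿ: a quotient of two everywhere-analytic functions. -/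
def Mero {n : ℕ} (f : (Fin n → ℂ) → ℂ) : Prop :=
  ∃ g h : (Fin n → ℂ) → ℂ, (∀ u, AnalyticAt ℂ g u) ∧ (∀ u, AnalyticAt ℂ h u) ∧
    (∃ u, h u ≠ 0) ∧ ∀ u, h u ≠ 0 → f u = g u / h u

/-- The Jacobian determinant of the family `φ` is not identically zero. -/
def AnalyticallyIndep {n : ℕ} (φ : Fin n → (Fin n → ℂ) → ℂ) : Prop :=
  ∃ u : Fin n → ℂ, (∀ j, AnalyticAt ℂ (φ j) u) ∧
    Matrix.det (Matrix.of fun k p => pd (φ k) p u) ≠ 0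

/-- `Φ = (φ₁,…,φ_n)` admits an algebraic addition theorem: for each `k` there is a
polynomial `G_k` in the variables `λ` (= `none`), `x_j` (= `some (inl j)`) and
`y_j` (= `some (inr j)`), of degree ≥ 1 in `λ`, with
`G_k(φ_k(u+v); φ(u), φ(v)) = 0` wherever all functions involved are analytic. -/
def AdmitsAAT {n : ℕ} (φ : Fin n → (Fin n → ℂ) → ℂ) : Prop :=
  ∀ k : Fin n, ∃ G : MvPolynomial (Option (Fin n ⊕ Fin n)) ℂ,
    1 ≤ G.degreeOf none ∧
    ∀ u v : Fin n → ℂ, (∀ j, AnalyticAt ℂ (φ j) u) → (∀ j, AnalyticAt ℂ (φ j) v) →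
      AnalyticAt ℂ (φ k) (u + v) →
      eval (fun i => i.elim (φ k (u + v)) (Sum.elim (fun j => φ j u) fun j => φ j v)) G = 0

/-- The valuation sending the variable `none` to `θ(u)` and `some j` to `φ_j(u)`. -/
noncomputable def tval {n : ℕ} (θ : (Fin n → ℂ) → ℂ) (φ : Fin n → (Fin n → ℂ) → ℂ)
    (u : Fin n → ℂ) : Option (Fin n) → ℂ :=
  fun i => i.elim (θ u) fun j => φ j u

/-- `f` is a rational function on ℂⁿ. -/
def RatFn {n : ℕ} (f : (Fin n → ℂ) → ℂ) : Prop :=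
  ∃ P Q : MvPolynomial (Fin n) ℂ, Q ≠ 0 ∧
    ∃ s : Set (Fin n → ℂ), IsOpen s ∧ s.Nonempty ∧
      ∀ u ∈ s, f u = eval u P / eval u Q


open MvPolynomial Filter Topology

section FieldTheory

variable {K : Type*} [Field K] [Algebra ℂ K]

lemma fld_exchange {n : ℕ} {x y : Fin n → K} (hx : AlgebraicIndependent ℂ x)
    (hy : AlgebraicIndependent ℂ y)
    (hyx : ∀ k, IsAlgebraic (Algebra.adjoin ℂ (Set.range x)) (y k)) {z : K}
    (hz : IsAlgebraic (Algebra.adjoin ℂ (Set.range x)) z) :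
    IsAlgebraic (Algebra.adjoin ℂ (Set.range y)) z := by
  classical
  let M := AlgebraicIndependent.matroid ℂ K
  have hcl : ∀ (s : Set K) (a : K), a ∈ M.closure s ↔ IsAlgebraic (Algebra.adjoin ℂ s) a := by
    intro s a
    rw [AlgebraicIndependent.matroid_closure_eq]
    exact Iff.rfl
  rw [← hcl] at hz ⊢
  have hyI : M.Indep (Set.range y) := AlgebraicIndependent.matroid_indep_iff.2 hy.to_subtype_range
  have hxI : M.Indep (Set.range x) := AlgebraicIndependent.matroid_indep_iff.2 hx.to_subtype_range
  have hsub : Set.range y ⊆ M.closure (Set.range x) := by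
    rintro _ ⟨k, rfl⟩; rw [hcl]; exact hyx k
  have hb : M.IsBasis (Set.range y) (M.closure (Set.range x)) := by
    refine hyI.isBasis_of_eRk_ge (Set.finite_range y) hsub ?_
    rw [Matroid.eRk_closure_eq, hxI.eRk_eq_encard, hyI.eRk_eq_encard,
      ← Set.image_univ, ← Set.image_univ, hx.injective.encard_image, hy.injective.encard_image]
  rw [hb.closure_eq_closure, Matroid.closure_closure]
  exact hz

lemma fld_alg_iff {n : ℕ} {x : Fin n → K} (hx : AlgebraicIndependent ℂ x) (z : K) :
    IsAlgebraic (Algebra.adjoin ℂ (Set.range x)) z ↔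
      ∃ T : MvPolynomial (Option (Fin n)) ℂ, T ≠ 0 ∧ aeval (fun o : Option (Fin n) => o.elim z x) T = 0 := by
  have h := AlgebraicIndependent.option_iff_transcendental hx z
  rw [Transcendental, algebraicIndependent_iff, ← not_iff_not] at h
  rw [not_not] at h
  rw [← h]
  push Not
  constructor
  · rintro ⟨p, h1, h2⟩; exact ⟨p, h2, h1⟩
  · rintro ⟨p, h1, h2⟩; exact ⟨p, h2, h1⟩

end FieldTheory

open MvPolynomial Filter Topology

section Germs

variable {E : Type*} [NormedAddCommGroup E] [NormedSpace ℂ E]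

lemma anal_mul_ne {U : Set E} (hU : IsPreconnected U) (hUo : IsOpen U) {f g : E → ℂ}
    (hf : AnalyticOnNhd ℂ f U) (hg : AnalyticOnNhd ℂ g U) (h1 : ∃ u ∈ U, f u ≠ 0)
    (h2 : ∃ u ∈ U, g u ≠ 0) : ∃ u ∈ U, f u ≠ 0 ∧ g u ≠ 0 := by
  by_contra hcon
  push Not at hcon
  obtain ⟨a, ha, hfa⟩ := h1
  obtain ⟨b, hb, hgb⟩ := h2
  have hev : g =ᶠ[𝓝 a] 0 := by
    filter_upwards [(hf a ha).continuousAt.eventually_ne hfa, hUo.mem_nhds ha] with u hu huU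
    exact hcon u huU hu
  exact hgb (hg.eqOn_zero_of_preconnected_of_eventuallyEq_zero hU ha hev hb)

lemma anal_mul_ev {u : E} {f g : E → ℂ} (hf : AnalyticAt ℂ f u) (hg : AnalyticAt ℂ g u)
    (h : ∀ᶠ x in 𝓝 u, f x * g x = 0) : (∀ᶠ x in 𝓝 u, f x = 0) ∨ (∀ᶠ x in 𝓝 u, g x = 0) := by
  have hall := (hf.eventually_analyticAt.and hg.eventually_analyticAt).and h
  obtain ⟨r, hr, hball⟩ := Metric.eventually_nhds_iff_ball.1 hall
  by_contra hcon
  push Not at hcon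
  obtain ⟨h1, h2⟩ := hcon
  have hb := Metric.ball_mem_nhds u hr
  have hne : ∀ k : E → ℂ, (∃ᶠ x in 𝓝 u, k x ≠ 0) → ∃ x ∈ Metric.ball u r, k x ≠ 0 := by
    intro k hk
    obtain ⟨x, hx, hx'⟩ := (hk.and_eventually hb).exists
    exact ⟨x, hx', hx⟩
  obtain ⟨x, hx, hx1, hx2⟩ := anal_mul_ne (convex_ball u r).isPreconnected Metric.isOpen_ball
    (fun x hx => (hball x hx).1.1) (fun x hx => (hball x hx).1.2) (hne f h1) (hne g h2)
  exact mul_ne_zero hx1 hx2 (hball x hx).2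

/-- functions analytic at a point -/
def AnAlg (u : E) : Subalgebra ℂ (E → ℂ) where
  carrier := {f | AnalyticAt ℂ f u}
  mul_mem' := fun ha hb => AnalyticAt.mul ha hb
  add_mem' := fun ha hb => AnalyticAt.add ha hb
  algebraMap_mem' := fun c => by
    change AnalyticAt ℂ (fun _ => c) u
    exact analyticAt_const

def AnIdeal (u : E) : Ideal (AnAlg u) where
  carrier := {f | ∀ᶠ x in 𝓝 u, (f : E → ℂ) x = 0}
  add_mem' := fun {a b} ha hb => by
    filter_upwards [ha, hb] with x h1 h2
    simp [h1, h2]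
  zero_mem' := by simp
  smul_mem' := fun c f hf => by
    filter_upwards [hf] with x h1
    simp [h1]

instance AnIdeal_prime (u : E) : (AnIdeal u).IsPrime := by
  constructor
  · rw [Ideal.ne_top_iff_one]
    intro h
    have h' : ∀ᶠ x in 𝓝 u, (1 : E → ℂ) x = 0 := h
    simpa using h'.self_of_nhds
  · rintro ⟨f, hf⟩ ⟨g, hg⟩ h
    exact anal_mul_ev hf hg h

/-- the ring of analytic germs -/
def AnRing (u : E) : Type _ := AnAlg u ⧸ AnIdeal u

noncomputable instance (u : E) : CommRing (AnRing u) :=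
  inferInstanceAs (CommRing (AnAlg u ⧸ AnIdeal u))

instance (u : E) : IsDomain (AnRing u) :=
  inferInstanceAs (IsDomain (AnAlg u ⧸ AnIdeal u))

noncomputable instance (u : E) : Algebra ℂ (AnRing u) :=
  inferInstanceAs (Algebra ℂ (AnAlg u ⧸ AnIdeal u))

noncomputable def anMk (u : E) : AnAlg u →ₐ[ℂ] AnRing u := Ideal.Quotient.mkₐ ℂ (AnIdeal u)

lemma anMk_eq_zero {u : E} (f : AnAlg u) : anMk u f = 0 ↔ ∀ᶠ x in 𝓝 u, (f : E → ℂ) x = 0 :=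
  Ideal.Quotient.eq_zero_iff_mem (I := AnIdeal u)

/-- the field of meromorphic germs -/
def AnField (u : E) : Type _ := FractionRing (AnRing u)

noncomputable instance (u : E) : Field (AnField u) :=
  inferInstanceAs (Field (FractionRing (AnRing u)))

noncomputable instance (u : E) : Algebra ℂ (AnField u) :=
  inferInstanceAs (Algebra ℂ (FractionRing (AnRing u)))

noncomputable def anInc (u : E) : AnRing u →ₐ[ℂ] AnField u :=
  IsScalarTower.toAlgHom ℂ (AnRing u) (FractionRing (AnRing u))

lemma anInc_inj (u : E) : Function.Injective (anInc u) :=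
  IsFractionRing.injective (AnRing u) (FractionRing (AnRing u))

noncomputable def gmHom (u : E) : AnAlg u →ₐ[ℂ] AnField u := (anInc u).comp (anMk u)

lemma gmHom_eq_zero {u : E} (f : AnAlg u) : gmHom u f = 0 ↔ ∀ᶠ x in 𝓝 u, (f : E → ℂ) x = 0 := by
  rw [gmHom, AlgHom.comp_apply, map_eq_zero_iff _ (anInc_inj u), anMk_eq_zero]

noncomputable def gm {u : E} (f : E → ℂ) (hf : AnalyticAt ℂ f u) : AnField u := gmHom u ⟨f, hf⟩

lemma gm_eq_zero {u : E} {f : E → ℂ} (hf : AnalyticAt ℂ f u) : gm f hf = 0 ↔ ∀ᶠ x in 𝓝 u, f x = 0 :=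
  gmHom_eq_zero _

lemma gm_mul {u : E} {f g : E → ℂ} (hf : AnalyticAt ℂ f u) (hg : AnalyticAt ℂ g u) :
    gm f hf * gm g hg = gm (fun x => f x * g x) (hf.mul hg) := by
  rw [gm, gm, ← map_mul]; rfl

lemma gm_congr {u : E} {f g : E → ℂ} (hf : AnalyticAt ℂ f u) (hg : AnalyticAt ℂ g u)
    (h : ∀ᶠ x in 𝓝 u, f x = g x) : gm f hf = gm g hg := by
  rw [← sub_eq_zero, gm, gm, ← map_sub, gmHom_eq_zero]
  filter_upwards [h] with x hx
  simp [hx]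

lemma aeval_AnAlg {τ : Type*} {u : E} (θ : τ → AnAlg u) (P : MvPolynomial τ ℂ) (x : E) :
    ((aeval θ P : AnAlg u) : E → ℂ) x = eval (fun t => (θ t : E → ℂ) x) P := by
  have h : ((Pi.evalAlgHom ℂ (fun _ : E => ℂ) x).comp ((AnAlg u).val.comp (aeval θ))) =
      aeval (fun t => (θ t : E → ℂ) x) := by
    apply MvPolynomial.algHom_ext
    intro i
    simp
  have := DFunLike.congr_fun h P
  simpa [MvPolynomial.coe_aeval_eq_eval] using this

lemma eval_analytic {τ : Type*} {u : E} {θ : τ → E → ℂ} (hθ : ∀ t, AnalyticAt ℂ (θ t) u)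
    (P : MvPolynomial τ ℂ) : AnalyticAt ℂ (fun x => eval (fun t => θ t x) P) u := by
  have := (aeval (fun t => (⟨θ t, hθ t⟩ : AnAlg u)) P).2
  change AnalyticAt ℂ _ u at this
  convert this using 1
  funext x
  exact (aeval_AnAlg (fun t => (⟨θ t, hθ t⟩ : AnAlg u)) P x).symm

lemma aeval_gm {τ : Type*} {u : E} {θ : τ → E → ℂ} (hθ : ∀ t, AnalyticAt ℂ (θ t) u)
    (P : MvPolynomial τ ℂ) :
    aeval (fun t => gm (θ t) (hθ t)) P = gm (fun x => eval (fun t => θ t x) P) (eval_analytic hθ P) := by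
  have : aeval (fun t => gm (θ t) (hθ t)) P = gmHom u (aeval (fun t => (⟨θ t, hθ t⟩ : AnAlg u)) P) := by
    rw [← AlgHom.comp_apply, MvPolynomial.comp_aeval]; rfl
  rw [this, gm]
  congr 1
  ext x
  exact aeval_AnAlg (fun t => (⟨θ t, hθ t⟩ : AnAlg u)) P x

lemma aeval_gm_eq_zero {τ : Type*} {u : E} {θ : τ → E → ℂ} (hθ : ∀ t, AnalyticAt ℂ (θ t) u)
    (P : MvPolynomial τ ℂ) :
    aeval (fun t => gm (θ t) (hθ t)) P = 0 ↔ ∀ᶠ x in 𝓝 u, eval (fun t => θ t x) P = 0 := by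
  rw [aeval_gm, gm_eq_zero]

end Germs

open MvPolynomial Filter Topology

section GermAlg

lemma mvpoly_zero_of_ev {σ : Type*} [Fintype σ] (P : MvPolynomial σ ℂ) (x : σ → ℂ)
    (h : ∀ᶠ y in 𝓝 x, eval y P = 0) : P = 0 := by
  obtain ⟨r, hr, hball⟩ := Metric.eventually_nhds_iff_ball.1 h
  refine MvPolynomial.funext_set (fun i => Metric.ball (x i) r) (fun i => ?_) ?_
  · exact infinite_of_mem_nhds (x i) (Metric.ball_mem_nhds _ hr)
  · intro y hy
    rw [map_zero]
    refine hball y ?_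
    rw [← ball_pi _ hr] at hy
    exact hy

variable {n : ℕ}

/-- `θ` is algebraic over `ℂ(φ)` near `u`. -/
def AG {m : ℕ} (θ : (Fin m → ℂ) → ℂ) (φ : Fin n → (Fin m → ℂ) → ℂ) (u : Fin m → ℂ) : Prop :=
  ∃ T : MvPolynomial (Option (Fin n)) ℂ, T ≠ 0 ∧
    ∀ᶠ x in 𝓝 u, eval (fun i : Option (Fin n) => i.elim (θ x) fun j => φ j x) T = 0

lemma gm_indep {m : ℕ} {φ : Fin n → (Fin m → ℂ) → ℂ} {u : Fin m → ℂ} (hφ : ∀ k, AnalyticAt ℂ (φ k) u)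
    (hmap : map (fun x k => φ k x) (𝓝 u) = 𝓝 (fun k => φ k u)) :
    AlgebraicIndependent ℂ (fun k => gm (φ k) (hφ k)) := by
  rw [algebraicIndependent_iff]
  intro P hP
  rw [aeval_gm_eq_zero] at hP
  apply mvpoly_zero_of_ev P (fun k => φ k u)
  rw [← hmap, eventually_map]
  exact hP

lemma AG_iff {m : ℕ} {θ : (Fin m → ℂ) → ℂ} {φ : Fin n → (Fin m → ℂ) → ℂ} {u : Fin m → ℂ}
    (hθ : AnalyticAt ℂ θ u) (hφ : ∀ k, AnalyticAt ℂ (φ k) u)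
    (hi : AlgebraicIndependent ℂ (fun k => gm (φ k) (hφ k))) :
    AG θ φ u ↔ IsAlgebraic (Algebra.adjoin ℂ (Set.range fun k => gm (φ k) (hφ k))) (gm θ hθ) := by
  rw [fld_alg_iff hi]
  unfold AG
  refine exists_congr fun T => and_congr Iff.rfl ?_
  let Θ : Option (Fin n) → (Fin m → ℂ) → ℂ := fun o => o.elim θ φ
  have hΘ : ∀ o, AnalyticAt ℂ (Θ o) u := by
    rintro (_ | j)
    · exact hθ
    · exact hφ j
  have h1 : (fun o : Option (Fin n) => o.elim (gm θ hθ) fun k => gm (φ k) (hφ k)) =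
      fun o => gm (Θ o) (hΘ o) := by
    funext o; cases o <;> rfl
  rw [h1, aeval_gm_eq_zero]
  have h2 : ∀ x, (fun i : Option (Fin n) => i.elim (θ x) fun j => φ j x) = fun o => Θ o x := by
    intro x; funext o; cases o <;> rfl
  simp only [h2]

lemma AG_exchange {m : ℕ} {θ : (Fin m → ℂ) → ℂ} {φ ψ : Fin n → (Fin m → ℂ) → ℂ} {u : Fin m → ℂ}
    (hθ : AnalyticAt ℂ θ u) (hφ : ∀ k, AnalyticAt ℂ (φ k) u) (hψ : ∀ k, AnalyticAt ℂ (ψ k) u)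
    (hi : AlgebraicIndependent ℂ (fun k => gm (φ k) (hφ k)))
    (hi' : AlgebraicIndependent ℂ (fun k => gm (ψ k) (hψ k)))
    (h1 : ∀ k, AG (ψ k) φ u) (h2 : AG θ φ u) : AG θ ψ u := by
  rw [AG_iff hθ hψ hi']
  exact fld_exchange hi hi' (fun k => (AG_iff (hψ k) hφ hi).1 (h1 k)) ((AG_iff hθ hφ hi).1 h2)

lemma fderiv_pi_equiv {f : (Fin n → ℂ) → Fin n → ℂ} {u : Fin n → ℂ} (hf : AnalyticAt ℂ f u)
    (hdet : Matrix.det (Matrix.of fun k p => pd (fun x => f x k) p u) ≠ 0) :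
    ∃ e : (Fin n → ℂ) ≃L[ℂ] (Fin n → ℂ), HasStrictFDerivAt f (e : (Fin n → ℂ) →L[ℂ] (Fin n → ℂ)) u := by
  have hs := hf.hasStrictFDerivAt
  have hd : (fderiv ℂ f u).det ≠ 0 := by
    have : (fderiv ℂ f u).det = Matrix.det (Matrix.of fun k p => pd (fun x => f x k) p u) := by
      rw [ContinuousLinearMap.det, ← LinearMap.det_toMatrix']
      congr 1
      ext k p
      simp only [LinearMap.toMatrix'_apply, Matrix.of_apply, pd]
      have h2 : HasFDerivAt (fun x => f x k) ((ContinuousLinearMap.proj k).comp (fderiv ℂ f u)) u :=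
        (ContinuousLinearMap.proj (R := ℂ) (φ := fun _ : Fin n => ℂ) k).hasFDerivAt.comp u
          hs.hasFDerivAt
      rw [h2.fderiv]
      simp [Pi.single]
    rw [this]; exact hdet
  refine ⟨(fderiv ℂ f u).toContinuousLinearEquivOfDetNeZero hd, ?_⟩
  simpa using hs

lemma nhds_map_of_det {φ : Fin n → (Fin n → ℂ) → ℂ} {u : Fin n → ℂ} (hφ : ∀ k, AnalyticAt ℂ (φ k) u)
    (hdet : Matrix.det (Matrix.of fun k p => pd (φ k) p u) ≠ 0) :
    map (fun x k => φ k x) (𝓝 u) = 𝓝 (fun k => φ k u) := by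
  have hf : AnalyticAt ℂ (fun x k => φ k x) u := analyticAt_pi_iff.2 hφ
  obtain ⟨e, he⟩ := fderiv_pi_equiv hf hdet
  exact he.map_nhds_eq_of_equiv

lemma pd_analytic {f : (Fin n → ℂ) → ℂ} {u : Fin n → ℂ} (hf : AnalyticAt ℂ f u) (p : Fin n) :
    AnalyticAt ℂ (pd f p) u := by
  have := hf.fderiv
  exact ((ContinuousLinearMap.apply ℂ ℂ (Pi.single p 1 : Fin n → ℂ)).analyticAt _).comp this

lemma det_mem_sub {K R : Type*} [CommRing R] [CommRing K] [Algebra R K] (S : Subalgebra R K)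
    (M : Matrix (Fin n) (Fin n) K) (h : ∀ i j, M i j ∈ S) : M.det ∈ S := by
  rw [Matrix.det_apply]
  refine S.sum_mem fun σ _ => ?_
  rw [Units.smul_def, zsmul_eq_mul]
  exact S.mul_mem (S.intCast_mem _) (S.prod_mem fun i _ => h _ _)

lemma inv_entry_alg {K : Type*} [Field K] [Algebra ℂ K] (s : Set K) (M N : Matrix (Fin n) (Fin n) K)
    (h : ∀ i j, IsAlgebraic (Algebra.adjoin ℂ s) (M i j)) (hMN : M * N = 1) (i j : Fin n) :
    IsAlgebraic (Algebra.adjoin ℂ s) (N i j) := by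
  let S := Subalgebra.algebraicClosure (Algebra.adjoin ℂ s) K
  have hS : ∀ z, z ∈ S ↔ IsAlgebraic (Algebra.adjoin ℂ s) z := fun z => Iff.rfl
  have hN : N = M⁻¹ := (Matrix.inv_eq_right_inv hMN).symm
  have hdet : M.det ∈ S := det_mem_sub S M h
  rw [hN, Matrix.inv_def, Matrix.smul_apply, smul_eq_mul, Ring.inverse_eq_inv']
  rw [← hS]
  refine S.mul_mem ?_ ?_
  · rw [hS] at hdet ⊢; exact hdet.inv
  · rw [Matrix.adjugate_apply]
    refine det_mem_sub S _ fun a b => ?_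
    rw [Matrix.updateRow_apply]
    split_ifs
    · rw [Pi.single_apply]; split_ifs
      · exact S.one_mem
      · exact S.zero_mem
    · exact h a b

/-- entries of inverse Jacobian -/
noncomputable def invJ (φ : Fin n → (Fin n → ℂ) → ℂ) (i k : Fin n) (u : Fin n → ℂ) : ℂ :=
  (Matrix.of fun k p => pd (φ k) p u)⁻¹ i k

lemma det_analytic {φ : Fin n → (Fin n → ℂ) → ℂ} {u : Fin n → ℂ} (hφ : ∀ k, AnalyticAt ℂ (φ k) u) :
    AnalyticAt ℂ (fun u => Matrix.det (Matrix.of fun k p => pd (φ k) p u)) u := by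
  simp only [Matrix.det_apply, Units.smul_def, zsmul_eq_mul]
  refine Finset.analyticAt_fun_sum _ fun σ _ => ?_
  refine analyticAt_const.mul ?_
  refine Finset.analyticAt_fun_prod _ fun i _ => ?_
  exact pd_analytic (hφ _) _

lemma invJ_analytic {φ : Fin n → (Fin n → ℂ) → ℂ} {u : Fin n → ℂ} (hφ : ∀ k, AnalyticAt ℂ (φ k) u)
    (hdet : Matrix.det (Matrix.of fun k p => pd (φ k) p u) ≠ 0) (i k : Fin n) :
    AnalyticAt ℂ (invJ φ i k) u := by
  unfold invJ
  simp only [Matrix.inv_def, Matrix.smul_apply, smul_eq_mul, Ring.inverse_eq_inv']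
  refine ((det_analytic hφ).inv hdet).mul ?_
  simp only [Matrix.adjugate_apply, Matrix.det_apply, Units.smul_def, zsmul_eq_mul]
  refine Finset.analyticAt_fun_sum _ fun σ _ => ?_
  refine analyticAt_const.mul ?_
  refine Finset.analyticAt_fun_prod _ fun a _ => ?_
  simp only [Matrix.updateRow_apply]
  split_ifs
  · exact analyticAt_const
  · exact pd_analytic (hφ _) _

lemma invJ_AG {φ : Fin n → (Fin n → ℂ) → ℂ} {u : Fin n → ℂ} (hφ : ∀ k, AnalyticAt ℂ (φ k) u)
    (hdet : Matrix.det (Matrix.of fun k p => pd (φ k) p u) ≠ 0)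
    (h : ∀ k p, AG (pd (φ k) p) φ u) (i k : Fin n) : AG (invJ φ i k) φ u := by
  have hi := gm_indep hφ (nhds_map_of_det hφ hdet)
  have hp : ∀ k p, AnalyticAt ℂ (pd (φ k) p) u := fun k p => pd_analytic (hφ k) p
  have hI := fun i k => invJ_analytic hφ hdet i k
  rw [AG_iff (hI i k) hφ hi]
  refine inv_entry_alg (n := n) _ (Matrix.of fun k p => gm (pd (φ k) p) (hp k p))
    (Matrix.of fun i k => gm (invJ φ i k) (hI i k)) (fun a b => ?_) ?_ i k
  · exact (AG_iff (hp a b) hφ hi).1 (h a b)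
  · ext a b
    rw [Matrix.mul_apply]
    simp only [Matrix.of_apply, gm, ← map_mul, ← map_sum]
    have : (1 : Matrix (Fin n) (Fin n) (AnField u)) a b = gmHom u (algebraMap ℂ _ ((1 : Matrix (Fin n) (Fin n) ℂ) a b)) := by
      rw [AlgHom.commutes, Matrix.one_apply, Matrix.one_apply]; split_ifs <;> simp
    rw [this, ← sub_eq_zero, ← map_sub, gmHom_eq_zero]
    filter_upwards [(det_analytic hφ).continuousAt.eventually_ne hdet] with x hx
    have hm := Matrix.mul_nonsing_inv (Matrix.of fun k p => pd (φ k) p x) (Ne.isUnit hx)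
    have hm' := congrFun (congrFun hm a) b
    rw [Matrix.mul_apply] at hm'
    simp only [AddSubgroupClass.coe_sub, AddSubmonoidClass.coe_finsetSum, MulMemClass.coe_mul, Pi.sub_apply, Finset.sum_apply, Pi.mul_apply]
    rw [sub_eq_zero]
    exact hm'

end GermAlg

open MvPolynomial Filter Topology

section PolyGrowth

lemma entire_poly {g : ℂ → ℂ} (hg : Differentiable ℂ g) (M : ℕ) (C : ℝ)
    (hC : ∀ᶠ t in Bornology.cobounded ℂ, ‖g t‖ ≤ C * ‖t‖ ^ M) :
    ∃ p : Polynomial ℂ, p.natDegree ≤ M ∧ ∀ t, g t = p.eval t := by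
  obtain ⟨R0, hR0⟩ : ∃ R0 : ℝ, ∀ t : ℂ, R0 ≤ ‖t‖ → ‖g t‖ ≤ C * ‖t‖ ^ M := by
    have := (hasBasis_cobounded_norm (E := ℂ)).eventually_iff.1 hC
    simpa using this
  have hk : ∀ k, M < k → iteratedDeriv k g 0 = 0 := by
    intro k hk
    have hb : ∀ᶠ R : ℝ in atTop, ‖iteratedDeriv k g 0‖ ≤ (k.factorial * |C|) * R⁻¹ := by
      filter_upwards [eventually_ge_atTop R0, eventually_ge_atTop (1:ℝ)] with R h1 h2
      have hR : 0 < R := by linarith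
      have := Complex.norm_iteratedDeriv_le_of_forall_mem_sphere_norm_le (C := |C| * R ^ M) (c := 0) k hR
        hg.diffContOnCl (fun z hz => by
          have hz' : ‖z‖ = R := by simpa using hz
          have := hR0 z (by rw [hz']; exact h1)
          rw [hz'] at this
          refine this.trans ?_
          gcongr
          exact le_abs_self C)
      refine this.trans ?_
      rw [div_le_iff₀ (by positivity)]
      have h3 : R ^ M ≤ R⁻¹ * R ^ k := by
        obtain ⟨d, rfl⟩ := Nat.exists_eq_add_of_lt hk
        have : R⁻¹ * R ^ (M + d + 1) = R ^ (M + d) := by rw [pow_succ]; field_simp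
        rw [this]
        exact pow_le_pow_right₀ h2 (by omega)
      calc (k.factorial : ℝ) * (|C| * R ^ M) = (k.factorial * |C|) * R ^ M := by ring
        _ ≤ (k.factorial * |C|) * (R⁻¹ * R ^ k) := by gcongr
        _ = _ := by ring
    have ht : Tendsto (fun R : ℝ => (k.factorial * |C|) * R⁻¹) atTop (𝓝 0) := by
      simpa using tendsto_inv_atTop_zero.const_mul ((k.factorial : ℝ) * |C|)
    have := ge_of_tendsto ht hb
    exact norm_le_zero_iff.1 this
  refine ⟨∑ k ∈ Finset.range (M + 1), Polynomial.C ((k.factorial : ℂ)⁻¹ * iteratedDeriv k g 0) * Polynomial.X ^ k, ?_, ?_⟩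
  · refine Polynomial.natDegree_sum_le_of_forall_le _ _ fun k hk => ?_
    refine (Polynomial.natDegree_C_mul_X_pow_le _ _).trans ?_
    have := Finset.mem_range.1 hk
    omega
  · intro t
    rw [← Complex.taylorSeries_eq_of_entire hg 0 t, Polynomial.eval_finsetSum]
    rw [tsum_eq_sum (s := Finset.range (M + 1))]
    · refine Finset.sum_congr rfl fun k _ => ?_
      simp; ring
    · intro k hk'
      rw [Finset.mem_range, not_lt] at hk'
      rw [hk k (by omega)]; simp

lemma poly1 (Z : Set ℂ) (hZ : ∀ t, ∀ᶠ s in 𝓝[≠] t, s ∉ Z) (f : ℂ → ℂ)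
    (hd : ∀ t, t ∉ Z → DifferentiableAt ℂ f t)
    (hb : ∀ t, ∃ B : ℝ, ∀ᶠ s in 𝓝[≠] t, ‖f s‖ ≤ B) (M : ℕ)
    (hg : ∃ C : ℝ, ∀ᶠ t in Bornology.cobounded ℂ, t ∉ Z → ‖f t‖ ≤ C * ‖t‖ ^ M) :
    ∃ p : Polynomial ℂ, p.natDegree ≤ M ∧ ∀ t, t ∉ Z → f t = p.eval t := by
  let g : ℂ → ℂ := fun t => limUnder (𝓝[≠] t) f
  have hgf : ∀ t, t ∉ Z → g t = f t := by
    intro t ht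
    exact ((hd t ht).continuousAt.tendsto.mono_left nhdsWithin_le_nhds).limUnder_eq
  have hgd : Differentiable ℂ g := by
    intro t
    obtain ⟨B, hB⟩ := hb t
    obtain ⟨r, hr, hball⟩ := Metric.eventually_nhds_iff_ball.1 (eventually_nhdsWithin_iff.1 ((hZ t).and hB))
    have h1 := Complex.differentiableOn_update_limUnder_of_bddAbove (f := f) (s := Metric.ball t r) (c := t)
      (Metric.ball_mem_nhds _ hr)
      (fun s hs => (hd s (hball s hs.1 hs.2).1).differentiableWithinAt)
      ⟨B, by rintro _ ⟨s, hs, rfl⟩; exact (hball s hs.1 hs.2).2⟩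
    refine (h1.differentiableAt (Metric.ball_mem_nhds _ hr)).congr_of_eventuallyEq ?_
    filter_upwards [Metric.ball_mem_nhds t hr] with s hs
    by_cases hst : s = t
    · subst hst; simp [g]
    · rw [Function.update_of_ne hst, hgf s (hball s hs hst).1]
  obtain ⟨C, hC⟩ := hg
  obtain ⟨p, hp, hpe⟩ := entire_poly hgd M C (by
    obtain ⟨R0, hR0⟩ : ∃ R0 : ℝ, ∀ t : ℂ, R0 ≤ ‖t‖ → t ∉ Z → ‖f t‖ ≤ C * ‖t‖ ^ M := by
      have := (hasBasis_cobounded_norm (E := ℂ)).eventually_iff.1 hC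
      simpa using this
    refine (hasBasis_cobounded_norm (E := ℂ)).eventually_iff.2 ⟨R0 + 1, trivial, fun t ht => ?_⟩
    have ht' : R0 + 1 ≤ ‖t‖ := ht
    have h1 : Tendsto (fun s => ‖g s‖) (𝓝[≠] t) (𝓝 ‖g t‖) :=
      (hgd.continuous.norm.tendsto t).mono_left nhdsWithin_le_nhds
    have h2 : Tendsto (fun s : ℂ => C * ‖s‖ ^ M) (𝓝[≠] t) (𝓝 (C * ‖t‖ ^ M)) :=
      ((by fun_prop : Continuous fun s : ℂ => C * ‖s‖ ^ M).tendsto t).mono_left nhdsWithin_le_nhds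
    refine le_of_tendsto_of_tendsto h1 h2 ?_
    have h3 : ∀ᶠ s : ℂ in 𝓝[≠] t, R0 ≤ ‖s‖ := by
      refine nhdsWithin_le_nhds ?_
      exact (continuous_norm.continuousAt.eventually_const_lt (by linarith : R0 < ‖t‖)).mono fun _ h => h.le
    filter_upwards [hZ t, h3] with s hs hs'
    rw [hgf s hs]
    exact hR0 s hs' hs)
  exact ⟨p, hp, fun t ht => by rw [← hgf t ht, hpe]⟩

lemma box_poly {σ : Type*} [Fintype σ] [DecidableEq σ] (s : σ → Set ℂ) (hs : ∀ i, (s i).Infinite) (M : ℕ)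
    (f : (σ → ℂ) → ℂ)
    (h : ∀ i, ∀ x ∈ Set.pi Set.univ s, ∃ p : Polynomial ℂ, p.natDegree ≤ M ∧
      ∀ t ∈ s i, f (Function.update x i t) = p.eval t) :
    ∃ P : MvPolynomial σ ℂ, ∀ x ∈ Set.pi Set.univ s, f x = eval x P := by
  have key : ∀ A : Finset σ, ∀ z ∈ Set.pi Set.univ s, ∃ P : MvPolynomial σ ℂ,
      ∀ x ∈ Set.pi Set.univ s, (∀ i, i ∉ A → x i = z i) → f x = eval x P := by
    intro A
    induction A using Finset.induction_on with
    | empty =>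
      intro z hz
      refine ⟨C (f z), fun x hx hxz => ?_⟩
      have : x = z := funext fun i => hxz i (by simp)
      simp [this]
    | insert a A ha ih =>
      intro z hz
      obtain ⟨T, hTs, hTc⟩ := (hs a).exists_subset_card_eq (M + 1)
      have hup : ∀ x ∈ Set.pi Set.univ s, ∀ c ∈ s a, Function.update x a c ∈ Set.pi Set.univ s := by
        intro x hx c hc i _
        by_cases hi : i = a
        · subst hi; simpa using hc
        · rw [Function.update_of_ne hi]; exact hx i trivial
      have hP : ∀ c : T, ∃ P : MvPolynomial σ ℂ, ∀ x ∈ Set.pi Set.univ s,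
          (∀ i, i ∉ A → x i = Function.update z a c i) → f x = eval x P :=
        fun c => ih _ (hup z hz c (hTs c.2))
      choose P hP using hP
      refine ⟨∑ c : T, bind₁ (fun i => if i = a then C (c : ℂ) else X i) (P c) *
        Polynomial.aeval (X a : MvPolynomial σ ℂ) (Lagrange.basis T id (c : ℂ)), fun x hx hxz => ?_⟩
      obtain ⟨p, hpd, hp⟩ := h a x hx
      have h1 : p = Lagrange.interpolate T id (fun c => p.eval c) := by
        refine Lagrange.eq_interpolate (v := id) Function.injective_id.injOn ?_
        rw [hTc]
        refine lt_of_le_of_lt Polynomial.degree_le_natDegree ?_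
        exact_mod_cast Nat.lt_succ_of_le hpd
      have h2 : f x = p.eval (x a) := by
        rw [← hp (x a) (hx a trivial), Function.update_eq_self]
      rw [h2, h1, Lagrange.interpolate_apply, Polynomial.eval_finsetSum, map_sum,
        ← Finset.sum_coe_sort]
      refine Finset.sum_congr rfl fun c _ => ?_
      rw [Polynomial.eval_mul, Polynomial.eval_C, map_mul]
      congr 1
      · rw [← hp c (hTs c.2), hP c _ (hup x hx c (hTs c.2))]
        · have : eval x (bind₁ (fun i => if i = a then C (c : ℂ) else X i) (P c)) =
              eval (fun i => eval x (if i = a then C (c : ℂ) else X i)) (P c) := by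
            change eval₂Hom _ _ _ = _
            rw [eval₂Hom_bind₁]; rfl
          rw [this]
          congr 2
          funext i
          by_cases hi : i = a
          · subst hi; simp
          · simp [hi]
        · intro i hi
          by_cases hia : i = a
          · subst hia; simp
          · rw [Function.update_of_ne hia, Function.update_of_ne hia]
            exact hxz i (by simp [hia, hi])
      · rw [Polynomial.aeval_def, Polynomial.hom_eval₂, Polynomial.eval, eval_X]
        congr 1
        ext; simp
  have hne : (Set.pi Set.univ s).Nonempty := Set.univ_pi_nonempty_iff.2 fun i => (hs i).nonempty
  obtain ⟨z, hz⟩ := hne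
  obtain ⟨P, hP⟩ := key Finset.univ z hz
  exact ⟨P, fun x hx => hP x hx (by simp)⟩

end PolyGrowth

open MvPolynomial Filter Topology

section Entire

variable {E : Type*} [NormedAddCommGroup E] [NormedSpace ℂ E]

lemma countable_of_disc (Z : Set ℂ) (hZ : ∀ t, ∀ᶠ s in 𝓝[≠] t, s ∉ Z) : Z.Countable := by
  have h : ∀ t, insert t Zᶜ ∈ 𝓝 t := by
    intro t
    have := eventually_nhdsWithin_iff.1 (hZ t)
    filter_upwards [this] with s hs
    by_cases hst : s = t
    · left; exact hst
    · right; exact hs hst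
  obtain ⟨s, hs, hcov⟩ := TopologicalSpace.countable_cover_nhds h
  refine hs.mono fun z hz => ?_
  have : z ∈ ⋃ x ∈ s, insert x Zᶜ := by rw [hcov]; trivial
  simp only [Set.mem_iUnion] at this
  obtain ⟨x, hx, hzx⟩ := this
  rcases hzx with rfl | h
  · exact hx
  · exact absurd hz h

lemma ent1_disc {F : ℂ → ℂ} (hF : ∀ t, AnalyticAt ℂ F t) (h0 : ∃ t, F t ≠ 0) (t : ℂ) :
    ∀ᶠ s in 𝓝[≠] t, F s ≠ 0 := by
  rcases (hF t).eventually_eq_zero_or_eventually_ne_zero with h | h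
  · obtain ⟨s, hs⟩ := h0
    exact absurd ((show AnalyticOnNhd ℂ F Set.univ from fun x _ => hF x).eqOn_zero_of_preconnected_of_eventuallyEq_zero
      isPreconnected_univ (Set.mem_univ t) h (Set.mem_univ s)) hs
  · exact h

lemma ent_freq {H : E → ℂ} (hH : ∀ u, AnalyticAt ℂ H u) (h0 : ∃ u, H u ≠ 0) (u : E) :
    ∃ᶠ x in 𝓝 u, H x ≠ 0 := by
  intro h
  simp only [not_not] at h
  obtain ⟨s, hs⟩ := h0
  exact absurd ((show AnalyticOnNhd ℂ H Set.univ from fun x _ => hH x).eqOn_zero_of_preconnected_of_eventuallyEq_zero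
      isPreconnected_univ (Set.mem_univ u) h (Set.mem_univ s)) hs

lemma ent_line {H : E → ℂ} (hH : ∀ u, AnalyticAt ℂ H u) (a v : E) (t : ℂ) :
    AnalyticAt ℂ (fun t : ℂ => H (a + t • v)) t := by
  refine (hH _).fun_comp ?_
  exact analyticAt_const.add (analyticAt_id.smul analyticAt_const)

lemma ent_preconn {H : E → ℂ} (hH : ∀ u, AnalyticAt ℂ H u) : IsPreconnected {u | H u ≠ 0} := by
  refine isPreconnected_of_forall_pair fun a ha b hb => ?_
  let F : ℂ → ℂ := fun t => H (a + t • (b - a))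
  have hF := ent_line hH a (b - a)
  have hd := ent1_disc hF ⟨0, by simpa using ha⟩
  have hc : {t | F t = 0}.Countable := countable_of_disc _ hd
  have hp := hc.isPathConnected_compl_of_one_lt_rank (by rw [Complex.rank_real_complex]; norm_num)
  refine ⟨(fun t : ℂ => a + t • (b - a)) '' {t | F t = 0}ᶜ, ?_, ?_, ?_, ?_⟩
  · rintro _ ⟨t, ht, rfl⟩; exact ht
  · exact ⟨0, by simpa [F] using ha, by simp⟩
  · exact ⟨1, by simpa [F] using hb, by simp⟩
  · exact hp.isConnected.isPreconnected.image _ (by fun_prop)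

lemma ent_open {H : E → ℂ} (hH : ∀ u, AnalyticAt ℂ H u) : IsOpen {u | H u ≠ 0} := by
  have : Continuous H := continuous_iff_continuousAt.2 fun u => (hH u).continuousAt
  exact isOpen_ne_fun this continuous_const

/-- identity theorem on the complement of an entire hypersurface -/
lemma ent_ident {H F : E → ℂ} (hH : ∀ u, AnalyticAt ℂ H u) (hF : ∀ u, H u ≠ 0 → AnalyticAt ℂ F u)
    {u0 : E} (hu0 : H u0 ≠ 0) (h : ∀ᶠ u in 𝓝 u0, F u = 0) {u : E} (hu : H u ≠ 0) : F u = 0 :=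
  (show AnalyticOnNhd ℂ F {u | H u ≠ 0} from fun x hx => hF x hx).eqOn_zero_of_preconnected_of_eventuallyEq_zero
    (ent_preconn hH) (show u0 ∈ {u | H u ≠ 0} from hu0) h hu

end Entire

open MvPolynomial Filter Topology

section Sep

lemma alg_sep {R K : Type*} [CommRing R] [IsDomain R] [CharZero R] [Field K] [Algebra R K]
    [FaithfulSMul R K] {z : K} (hz : IsAlgebraic R z) :
    ∃ (Q A B : Polynomial R) (D : R), D ≠ 0 ∧ A * Q + B * Polynomial.derivative Q = Polynomial.C D ∧
      Q.leadingCoeff ∣ D ∧ Polynomial.aeval z Q = 0 := by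
  let F := FractionRing R
  have hinj : Function.Injective (algebraMap R F) := IsFractionRing.injective R F
  have : CharZero F := charZero_of_injective_algebraMap hinj
  let _ : Algebra F K := FractionRing.liftAlgebra R K
  have hzF : IsAlgebraic F z := hz.extendScalars hinj
  have hzI : IsIntegral F z := hzF.isIntegral
  have hsep : (minpoly F z).Separable := (minpoly.irreducible hzI).separable
  obtain ⟨a, c, hac⟩ := hsep
  obtain ⟨b1, hm1, hb1⟩ := IsLocalization.integerNormalization_spec (nonZeroDivisors R) (minpoly F z)
  obtain ⟨b2, hm2, hb2⟩ := IsLocalization.integerNormalization_spec (nonZeroDivisors R) a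
  obtain ⟨b3, hm3, hb3⟩ := IsLocalization.integerNormalization_spec (nonZeroDivisors R) c
  set Q := IsLocalization.integerNormalization (nonZeroDivisors R) (minpoly F z)
  set A := IsLocalization.integerNormalization (nonZeroDivisors R) a
  set B := IsLocalization.integerNormalization (nonZeroDivisors R) c
  rw [Algebra.smul_def, Polynomial.algebraMap_apply] at hb1 hb2 hb3
  have hQ0 : Q ≠ 0 := by
    intro h0
    rw [h0, Polynomial.map_zero] at hb1
    rcases mul_eq_zero.1 hb1.symm with h | h
    · rw [Polynomial.C_eq_zero, map_eq_zero_iff _ hinj] at h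
      exact nonZeroDivisors.ne_zero hm1 h
    · exact minpoly.ne_zero hzI h
  refine ⟨Q, Polynomial.C (Q.leadingCoeff * b3) * A, Polynomial.C (Q.leadingCoeff * b2) * B,
    Q.leadingCoeff * (b1 * b2 * b3), ?_, ?_, Dvd.intro _ rfl, ?_⟩
  · refine mul_ne_zero (by simpa using hQ0) (mul_ne_zero (mul_ne_zero ?_ ?_) ?_)
    all_goals exact nonZeroDivisors.ne_zero (by assumption)
  · apply Polynomial.map_injective _ hinj
    simp only [Polynomial.map_add, Polynomial.map_mul, Polynomial.map_C, ← Polynomial.derivative_map, hb1, hb2, hb3,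
      Polynomial.derivative_mul, Polynomial.derivative_C, map_mul]
    linear_combination (Polynomial.C (algebraMap R F Q.leadingCoeff) * Polynomial.C (algebraMap R F b1) * Polynomial.C (algebraMap R F b2) * Polynomial.C (algebraMap R F b3)) * hac
  · have : Polynomial.aeval z (Q.map (algebraMap R F)) = 0 := by
      rw [hb1, map_mul, minpoly.aeval, mul_zero]
    rwa [Polynomial.aeval_map_algebraMap] at this

/-- evaluation of a polynomial with polynomial coefficients -/
noncomputable def Qe {σ : Type*} (Q : Polynomial (MvPolynomial σ ℂ)) (x : σ → ℂ) (y : ℂ) : ℂ :=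
  (Q.map (eval x)).eval y

lemma Qe_eq {σ : Type*} (Q : Polynomial (MvPolynomial σ ℂ)) (x : σ → ℂ) (y : ℂ) :
    Qe Q x y = Polynomial.eval₂ (eval x) y Q := by
  rw [Qe, Polynomial.eval_map]

lemma Qe_mul {σ : Type*} (P Q : Polynomial (MvPolynomial σ ℂ)) (x : σ → ℂ) (y : ℂ) :
    Qe (P * Q) x y = Qe P x y * Qe Q x y := by simp [Qe]

lemma Qe_add {σ : Type*} (P Q : Polynomial (MvPolynomial σ ℂ)) (x : σ → ℂ) (y : ℂ) :
    Qe (P + Q) x y = Qe P x y + Qe Q x y := by simp [Qe]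

lemma Qe_C {σ : Type*} (D : MvPolynomial σ ℂ) (x : σ → ℂ) (y : ℂ) :
    Qe (Polynomial.C D) x y = eval x D := by simp [Qe]

lemma opt_eval₂ {σ K : Type*} [CommRing K] [Algebra ℂ K] (x : σ → K) (z : K)
    (T : MvPolynomial (Option σ) ℂ) :
    Polynomial.eval₂ (aeval x : MvPolynomial σ ℂ →ₐ[ℂ] K).toRingHom z (optionEquivLeft ℂ σ T) =
      aeval (fun o : Option σ => o.elim z x) T := by
  induction T using MvPolynomial.induction_on with
  | C a => simp [optionEquivLeft_C]
  | add p q hp hq => rw [map_add, Polynomial.eval₂_add, hp, hq, map_add]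
  | mul_X p o hp =>
    rw [map_mul, Polynomial.eval₂_mul, hp, map_mul]
    cases o <;> simp [optionEquivLeft_X_none, optionEquivLeft_X_some]

lemma Qe_opt {σ : Type*} (Q : Polynomial (MvPolynomial σ ℂ)) (x : σ → ℂ) (y : ℂ) :
    Qe Q x y = eval (fun o : Option σ => o.elim y x) ((optionEquivLeft ℂ σ).symm Q) := by
  have := opt_eval₂ x y ((optionEquivLeft ℂ σ).symm Q)
  rw [AlgEquiv.apply_symm_apply] at this
  rw [Qe_eq]
  exact this

variable {E : Type*} [NormedAddCommGroup E] [NormedSpace ℂ E]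

lemma Qe_analytic {σ : Type*} (Q : Polynomial (MvPolynomial σ ℂ)) {u : E} {θ : σ → E → ℂ}
    {b : E → ℂ} (hθ : ∀ t, AnalyticAt ℂ (θ t) u) (hb : AnalyticAt ℂ b u) :
    AnalyticAt ℂ (fun x => Qe Q (fun j => θ j x) (b x)) u := by
  simp only [Qe_opt]
  have := eval_analytic (θ := fun o : Option σ => o.elim b θ) (u := u)
    (by rintro (_ | j); exacts [hb, hθ j]) ((optionEquivLeft ℂ σ).symm Q)
  convert this using 4 with x
  funext o
  cases o <;> rfl

lemma sep_rel {σ : Type*} {u : E} {φ : σ → E → ℂ} (hφ : ∀ k, AnalyticAt ℂ (φ k) u)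
    (hi : AlgebraicIndependent ℂ (fun k => gm (φ k) (hφ k))) {b : E → ℂ} (hb : AnalyticAt ℂ b u)
    (halg : ∃ T : MvPolynomial (Option σ) ℂ, T ≠ 0 ∧
      ∀ᶠ x in 𝓝 u, eval (fun i : Option σ => i.elim (b x) fun j => φ j x) T = 0) :
    ∃ (Q A B : Polynomial (MvPolynomial σ ℂ)) (D : MvPolynomial σ ℂ), D ≠ 0 ∧
      A * Q + B * Polynomial.derivative Q = Polynomial.C D ∧
      Q.leadingCoeff ∣ D ∧ ∀ᶠ x in 𝓝 u, Qe Q (fun j => φ j x) (b x) = 0 := by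
  obtain ⟨T, hT0, hT⟩ := halg
  let ι : MvPolynomial σ ℂ →ₐ[ℂ] AnField u := aeval (fun k => gm (φ k) (hφ k))
  let _ : Algebra (MvPolynomial σ ℂ) (AnField u) := ι.toRingHom.toAlgebra
  have : FaithfulSMul (MvPolynomial σ ℂ) (AnField u) :=
    (faithfulSMul_iff_algebraMap_injective _ _).2 hi
  let Θ : Option σ → E → ℂ := fun o => o.elim b φ
  have hΘ : ∀ o, AnalyticAt ℂ (Θ o) u := by
    rintro (_ | j)
    · exact hb
    · exact hφ j
  have h1 : (fun o : Option σ => o.elim (gm b hb) fun k => gm (φ k) (hφ k)) =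
      fun o => gm (Θ o) (hΘ o) := by
    funext o; cases o <;> rfl
  have h2 : ∀ x, (fun i : Option σ => i.elim (b x) fun j => φ j x) = fun o => Θ o x := by
    intro x; funext o; cases o <;> rfl
  have key : ∀ S : MvPolynomial (Option σ) ℂ, Polynomial.aeval (gm b hb) (optionEquivLeft ℂ σ S) = 0 ↔
      ∀ᶠ x in 𝓝 u, eval (fun i : Option σ => i.elim (b x) fun j => φ j x) S = 0 := by
    intro S
    have h3 : Polynomial.aeval (gm b hb) (optionEquivLeft ℂ σ S) =
      aeval (fun o : Option σ => o.elim (gm b hb) fun k => gm (φ k) (hφ k)) S := opt_eval₂ _ _ _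
    rw [h3, h1, aeval_gm_eq_zero]
    simp only [h2]
  have hz : IsAlgebraic (MvPolynomial σ ℂ) (gm b hb) :=
    ⟨optionEquivLeft ℂ σ T, by simpa using hT0, (key T).2 hT⟩
  obtain ⟨Q, A, B, D, hD, hQ, hl, h0⟩ := alg_sep hz
  refine ⟨Q, A, B, D, hD, hQ, hl, ?_⟩
  have := (key ((optionEquivLeft ℂ σ).symm Q)).1 (by rwa [AlgEquiv.apply_symm_apply])
  filter_upwards [this] with x hx
  rw [Qe_opt]; exact hx

lemma eval_hasDerivAt {τ : Type*} [Fintype τ] (G : MvPolynomial τ ℂ) {θ : τ → ℂ → ℂ} {θ' : τ → ℂ}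
    {s : ℂ} (h : ∀ o, HasDerivAt (θ o) (θ' o) s) :
    HasDerivAt (fun s => eval (fun o => θ o s) G)
      (∑ o, eval (fun o => θ o s) (pderiv o G) * θ' o) s := by
  classical
  induction G using MvPolynomial.induction_on with
  | C a => simpa using hasDerivAt_const s a
  | add p q hp hq =>
    simp only [map_add, add_mul, Finset.sum_add_distrib]
    exact hp.add hq
  | mul_X p i hp =>
    have := hp.mul (h i)
    have e : (fun s => eval (fun o => θ o s) (p * X i)) = (fun s => eval (fun o => θ o s) p) * θ i := by
      funext s; simp
    rw [e]
    refine this.congr_deriv ?_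
    simp only [Derivation.leibniz, pderiv_X, smul_eq_mul, map_add, map_mul, eval_X, add_mul,
      Finset.sum_add_distrib]
    have h1 : ∑ x, eval (fun o => θ o s) p * eval (fun o => θ o s) ((Pi.single x 1 : τ → MvPolynomial τ ℂ) i) * θ' x =
        eval (fun o => θ o s) p * θ' i := by
      rw [Finset.sum_eq_single i]
      · simp
      · intro o _ ho; simp [Pi.single_apply, Ne.symm ho]
      · simp
    have h2 : ∑ x, θ i s * eval (fun o => θ o s) (pderiv x p) * θ' x =
        (∑ o, eval (fun o => θ o s) (pderiv o p) * θ' o) * θ i s := by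
      rw [Finset.sum_mul]
      refine Finset.sum_congr rfl fun o _ => ?_
      ring
    rw [h1, h2]
    ring

end Sep

open MvPolynomial Filter Topology

section Setup

variable {n : ℕ}

/-- common denominators and Jacobian collected in one entire function `H` -/
structure Good (φ g h : Fin n → (Fin n → ℂ) → ℂ) (H : (Fin n → ℂ) → ℂ) : Prop where
  hg : ∀ k u, AnalyticAt ℂ (g k) u
  hh : ∀ k u, AnalyticAt ℂ (h k) u
  hH : ∀ u, AnalyticAt ℂ H u
  ne : ∃ u, H u ≠ 0
  hk : ∀ u, H u ≠ 0 → ∀ k, h k u ≠ 0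
  phi : ∀ k u, h k u ≠ 0 → φ k u = g k u / h k u
  det : ∀ u, H u ≠ 0 → Matrix.det (Matrix.of fun k p => pd (φ k) p u) ≠ 0

lemma an_of_quot {f g h : (Fin n → ℂ) → ℂ} (hg : ∀ u, AnalyticAt ℂ g u) (hh : ∀ u, AnalyticAt ℂ h u)
    (hf : ∀ u, h u ≠ 0 → f u = g u / h u) {u : Fin n → ℂ} (hu : h u ≠ 0) : AnalyticAt ℂ f u := by
  refine ((hg u).div (hh u) hu).congr ?_
  filter_upwards [(hh u).continuousAt.eventually_ne hu] with x hx
  rw [hf x hx]; rfl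

lemma Good.an {φ g h : Fin n → (Fin n → ℂ) → ℂ} {H : (Fin n → ℂ) → ℂ} (G : Good φ g h H)
    {u : Fin n → ℂ} (hu : H u ≠ 0) (k : Fin n) : AnalyticAt ℂ (φ k) u :=
  an_of_quot (G.hg k) (G.hh k) (G.phi k) (G.hk u hu k)

lemma pd_quot {f g h : (Fin n → ℂ) → ℂ} (hg : ∀ u, AnalyticAt ℂ g u) (hh : ∀ u, AnalyticAt ℂ h u)
    (hf : ∀ u, h u ≠ 0 → f u = g u / h u) {u : Fin n → ℂ} (hu : h u ≠ 0) (p : Fin n) :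
    h u * pd g p u - g u * pd h p u = h u ^ 2 * pd f p u := by
  have hfa := an_of_quot hg hh hf hu
  have h1 : g =ᶠ[𝓝 u] fun x => h x * f x := by
    filter_upwards [(hh u).continuousAt.eventually_ne hu] with x hx
    rw [hf x hx]; field_simp
  have h2 : pd g p u = h u * pd f p u + f u * pd h p u := by
    unfold pd
    rw [h1.fderiv_eq, fderiv_fun_mul (hh u).differentiableAt hfa.differentiableAt]
    simp
  rw [h2, hf u hu]; field_simp; ring

lemma exists_good (φ : Fin n → (Fin n → ℂ) → ℂ)
    (hmero : ∀ k, Mero (φ k)) (hindep : AnalyticallyIndep φ) : ∃ g h H, Good φ g h H := by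
  choose g h hg hh hne hφ using hmero
  let Δ : (Fin n → ℂ) → ℂ := fun u =>
    Matrix.det (Matrix.of fun k p => h k u * pd (g k) p u - g k u * pd (h k) p u)
  have hΔ : ∀ u, AnalyticAt ℂ Δ u := by
    intro u
    simp only [Δ, Matrix.det_apply, Units.smul_def, zsmul_eq_mul]
    refine Finset.analyticAt_fun_sum _ fun σ _ => analyticAt_const.mul ?_
    refine Finset.analyticAt_fun_prod _ fun i _ => ?_
    exact ((hh _ u).mul (pd_analytic (hg _ u) _)).sub ((hg _ u).mul (pd_analytic (hh _ u) _))
  let H0 : (Fin n → ℂ) → ℂ := fun u => ∏ k, h k u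
  have hH0 : ∀ u, AnalyticAt ℂ H0 u := fun u => Finset.analyticAt_fun_prod _ fun k _ => hh k u
  have hH0ne : ∃ u, H0 u ≠ 0 := by
    have : ∀ S : Finset (Fin n), ∃ u, ∏ k ∈ S, h k u ≠ 0 := by
      intro S
      induction S using Finset.induction_on with
      | empty => exact ⟨0, by simp⟩
      | insert a S ha ih =>
        obtain ⟨u, -, h1, h2⟩ := anal_mul_ne (E := Fin n → ℂ) (U := Set.univ) isPreconnected_univ isOpen_univ
          (f := h a) (g := fun u => ∏ k ∈ S, h k u) (fun u _ => hh a u)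
          (fun u _ => Finset.analyticAt_fun_prod _ fun k _ => hh k u)
          (by obtain ⟨u, hu⟩ := hne a; exact ⟨u, trivial, hu⟩)
          (by obtain ⟨u, hu⟩ := ih; exact ⟨u, trivial, hu⟩)
        exact ⟨u, by rw [Finset.prod_insert ha]; exact mul_ne_zero h1 h2⟩
    exact this Finset.univ
  have hrel : ∀ u, (∀ k, h k u ≠ 0) → Δ u = (∏ k, h k u ^ 2) * Matrix.det (Matrix.of fun k p => pd (φ k) p u) := by
    intro u hu
    rw [← Matrix.det_mul_column]
    simp only [Δ]
    congr 1
    ext k p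
    simp only [Matrix.of_apply]
    exact pd_quot (hg k) (hh k) (hφ k) (hu k) p
  refine ⟨g, h, fun u => H0 u * Δ u, hg, hh, fun u => (hH0 u).mul (hΔ u), ?_, ?_, hφ, ?_⟩
  · obtain ⟨u, hua, hud⟩ := hindep
    have h1 := (det_analytic hua).continuousAt.eventually_ne hud
    obtain ⟨x, hx, hx'⟩ := ((ent_freq hH0 hH0ne u).and_eventually h1).exists
    refine ⟨x, mul_ne_zero hx ?_⟩
    have hxk : ∀ k, h k x ≠ 0 := fun k => Finset.prod_ne_zero_iff.1 hx k (Finset.mem_univ k)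
    rw [hrel x hxk]
    exact mul_ne_zero (Finset.prod_ne_zero_iff.2 fun k _ => pow_ne_zero _ (hxk k)) hx'
  · intro u hu k
    exact Finset.prod_ne_zero_iff.1 (left_ne_zero_of_mul hu) k (Finset.mem_univ k)
  · intro u hu
    have hxk : ∀ k, h k u ≠ 0 := fun k => Finset.prod_ne_zero_iff.1 (left_ne_zero_of_mul hu) k (Finset.mem_univ k)
    have := right_ne_zero_of_mul hu
    rw [hrel u hxk] at this
    exact right_ne_zero_of_mul this

lemma Good.indep {φ g h : Fin n → (Fin n → ℂ) → ℂ} {H : (Fin n → ℂ) → ℂ} (G : Good φ g h H)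
    {u : Fin n → ℂ} (hu : H u ≠ 0) : AlgebraicIndependent ℂ (fun k => gm (φ k) (G.an hu k)) :=
  gm_indep _ (nhds_map_of_det (G.an hu) (G.det u hu))

/-- joint independence -/
lemma joint_indep {φ g h : Fin n → (Fin n → ℂ) → ℂ} {H : (Fin n → ℂ) → ℂ} (G : Good φ g h H)
    {u v : Fin n → ℂ} (hu : H u ≠ 0) (hv : H v ≠ 0) (P : MvPolynomial (Fin n ⊕ Fin n) ℂ)
    (hP : ∀ᶠ c : (Fin n → ℂ) × (Fin n → ℂ) in 𝓝 (u, v),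
      eval (Sum.elim (fun j => φ j c.1) fun j => φ j c.2) P = 0) : P = 0 := by
  have m1 := nhds_map_of_det (G.an hu) (G.det u hu)
  have m2 := nhds_map_of_det (G.an hv) (G.det v hv)
  have h1 : ∀ᶠ c : (Fin n → ℂ) × (Fin n → ℂ) in 𝓝 (fun k => φ k u, fun k => φ k v),
      eval (Sum.elim c.1 c.2) P = 0 := by
    rw [nhds_prod_eq, ← m1, ← m2, Filter.prod_map_map_eq, eventually_map, ← nhds_prod_eq]
    exact hP
  apply mvpoly_zero_of_ev P (Sum.elim (fun k => φ k u) fun k => φ k v)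
  have hc : Continuous (fun z : Fin n ⊕ Fin n → ℂ => ((fun k => z (Sum.inl k), fun k => z (Sum.inr k)) : (Fin n → ℂ) × (Fin n → ℂ))) := by
    fun_prop
  have := hc.tendsto (Sum.elim (fun k => φ k u) fun k => φ k v)
  filter_upwards [this.eventually h1] with z hz
  convert hz using 3
  funext o; cases o <;> rfl

end Setup

open MvPolynomial Filter Topology

section DerivAlg

lemma pderiv_none_Qe {σ : Type*} [Fintype σ] (Q : Polynomial (MvPolynomial σ ℂ)) (x : σ → ℂ) (y : ℂ) :
    eval (fun o : Option σ => o.elim y x) (pderiv none ((optionEquivLeft ℂ σ).symm Q)) =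
      Qe (Polynomial.derivative Q) x y := by
  have h1 := eval_hasDerivAt ((optionEquivLeft ℂ σ).symm Q)
    (θ := fun o : Option σ => fun s : ℂ => o.elim s x) (θ' := fun o : Option σ => o.elim 1 fun _ => 0) (s := y)
    (by rintro (_ | j); exacts [hasDerivAt_id y, hasDerivAt_const y _])
  simp only [Fintype.sum_option, Option.elim, mul_one, mul_zero, Finset.sum_const_zero, add_zero] at h1
  have h2 : HasDerivAt (fun s => Qe Q x s) (Qe (Polynomial.derivative Q) x y) y := by
    have := (Q.map (eval x)).hasDerivAt y
    unfold Qe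
    rwa [Polynomial.derivative_map] at this
  have h3 : (fun s => Qe Q x s) = fun s => eval (fun o : Option σ => o.elim s x) ((optionEquivLeft ℂ σ).symm Q) := by
    funext s; rw [Qe_opt]
  rw [h3] at h2
  exact h1.unique h2

variable {n : ℕ}

lemma pd_line {f : (Fin n → ℂ) → ℂ} {u : Fin n → ℂ} (hf : AnalyticAt ℂ f u) (p : Fin n) :
    HasDerivAt (fun s : ℂ => f (u + s • Pi.single p 1)) (pd f p u) 0 := by
  have h1 : HasDerivAt (fun s : ℂ => u + s • (Pi.single p 1 : Fin n → ℂ)) (Pi.single p 1) 0 := by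
    simpa using ((hasDerivAt_id (0:ℂ)).smul_const (Pi.single p 1 : Fin n → ℂ)).const_add u
  have h2 : HasFDerivAt f (fderiv ℂ f u) (u + (0:ℂ) • (Pi.single p 1 : Fin n → ℂ)) := by
    simpa using hf.differentiableAt.hasFDerivAt
  exact h2.comp_hasDerivAt (0:ℂ) h1

lemma pd_translate (f : (Fin n → ℂ) → ℂ) (v : Fin n → ℂ) (p : Fin n) (u : Fin n → ℂ) :
    pd (fun x => f (x + v)) p u = pd f p (u + v) := by
  unfold pd
  rw [fderiv_comp_add_right]

lemma deriv_AG {φ g h : Fin n → (Fin n → ℂ) → ℂ} {H : (Fin n → ℂ) → ℂ} (G : Good φ g h H)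
    (haat : AdmitsAAT φ) : ∃ u, H u ≠ 0 ∧ ∀ k p, AG (pd (φ k) p) φ u := by
  obtain ⟨u0, hu0⟩ := G.ne
  obtain ⟨v0, -, hv0, huv0⟩ := anal_mul_ne (E := Fin n → ℂ) (U := Set.univ) isPreconnected_univ isOpen_univ
    (f := H) (g := fun v => H (u0 + v)) (fun u _ => G.hH u)
    (fun u _ => (G.hH _).fun_comp (analyticAt_const.add analyticAt_id))
    ⟨u0, trivial, hu0⟩ ⟨0, trivial, by simpa using hu0⟩
  -- the joint functions
  let ξ : Fin n ⊕ Fin n → (Fin n → ℂ) × (Fin n → ℂ) → ℂ :=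
    fun s c => Sum.elim (fun j => φ j c.1) (fun j => φ j c.2) s
  have hξ : ∀ {u v : Fin n → ℂ}, H u ≠ 0 → H v ≠ 0 → ∀ s, AnalyticAt ℂ (ξ s) (u, v) := by
    rintro u v hu hv (j | j)
    · exact (G.an hu j).fun_comp_of_eq (f := Prod.fst) analyticAt_fst rfl
    · exact (G.an hv j).fun_comp_of_eq (f := Prod.snd) analyticAt_snd rfl
  have hξi : AlgebraicIndependent ℂ (fun s => gm (ξ s) (hξ hu0 hv0 s)) := by
    rw [algebraicIndependent_iff]
    intro P hP
    rw [aeval_gm_eq_zero] at hP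
    exact joint_indep G hu0 hv0 P hP
  have hadd : ∀ c : (Fin n → ℂ) × (Fin n → ℂ), AnalyticAt ℂ (fun c : (Fin n → ℂ) × (Fin n → ℂ) => c.1 + c.2) c :=
    fun c => analyticAt_fst.add analyticAt_snd
  have hz : ∀ k, AnalyticAt ℂ (fun c : (Fin n → ℂ) × (Fin n → ℂ) => φ k (c.1 + c.2)) (u0, v0) := fun k =>
    (G.an huv0 k).fun_comp_of_eq (hadd _) rfl
  have cH : Continuous H := continuous_iff_continuousAt.2 fun u => (G.hH u).continuousAt
  have hgen : ∀ᶠ c : (Fin n → ℂ) × (Fin n → ℂ) in 𝓝 (u0, v0), H c.1 ≠ 0 ∧ H c.2 ≠ 0 ∧ H (c.1 + c.2) ≠ 0 := by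
    have h1 : ∀ᶠ c : (Fin n → ℂ) × (Fin n → ℂ) in 𝓝 (u0, v0), H c.1 ≠ 0 :=
      (cH.comp continuous_fst).continuousAt.eventually_ne hu0
    have h2 : ∀ᶠ c : (Fin n → ℂ) × (Fin n → ℂ) in 𝓝 (u0, v0), H c.2 ≠ 0 :=
      (cH.comp continuous_snd).continuousAt.eventually_ne hv0
    have h3 : ∀ᶠ c : (Fin n → ℂ) × (Fin n → ℂ) in 𝓝 (u0, v0), H (c.1 + c.2) ≠ 0 :=
      (cH.comp (continuous_fst.add continuous_snd)).continuousAt.eventually_ne huv0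
    exact h1.and (h2.and h3)
  have hsep := fun k => sep_rel (hξ hu0 hv0) hξi (hz k) (by
    obtain ⟨T, hT1, hT⟩ := haat k
    refine ⟨T, ?_, ?_⟩
    · rintro rfl; simp at hT1
    · filter_upwards [hgen] with c hc
      exact hT c.1 c.2 (G.an hc.1) (G.an hc.2.1) (G.an hc.2.2 k))
  choose Q A B D hD hQ _ hrel using hsep
  have hDp : ∏ k, D k ≠ 0 := Finset.prod_ne_zero_iff.2 fun k _ => hD k
  have hfreq : ∃ᶠ c in 𝓝 (u0, v0), eval (fun s => ξ s c) (∏ k, D k) ≠ 0 := by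
    intro hcon
    simp only [not_not] at hcon
    exact hDp (joint_indep G hu0 hv0 _ hcon)
  have hrel' := (eventually_all.2 hrel).eventually_nhds
  obtain ⟨⟨u1, v1⟩, hc1, ⟨hu1, hv1, huv1⟩, hc3⟩ := (hfreq.and_eventually (hgen.and hrel')).exists
  simp only at hu1 hv1 huv1
  have hD1 : ∀ k, eval (fun s => ξ s (u1, v1)) (D k) ≠ 0 := by
    rw [map_prod] at hc1
    exact fun k => Finset.prod_ne_zero_iff.1 hc1 k (Finset.mem_univ k)
  have hrel1 : ∀ k, ∀ᶠ c : (Fin n → ℂ) × (Fin n → ℂ) in 𝓝 (u1, v1), Qe (Q k) (fun s => ξ s c) (φ k (c.1 + c.2)) = 0 :=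
    fun k => hc3.mono fun c hc => hc k
  have tr : ∀ x : Fin n → ℂ, AnalyticAt ℂ (fun x : Fin n → ℂ => x + v1) x := fun x =>
    analyticAt_id.add analyticAt_const
  -- translated functions
  let ψ : Fin n → (Fin n → ℂ) → ℂ := fun k x => φ k (x + v1)
  have hψ : ∀ k, AnalyticAt ℂ (ψ k) u1 := fun k => (G.an huv1 k).fun_comp_of_eq (tr _) rfl
  have hφi := G.indep hu1
  have hψi : AlgebraicIndependent ℂ (fun k => gm (ψ k) (hψ k)) := by
    refine gm_indep hψ (nhds_map_of_det hψ ?_)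
    simp only [ψ, pd_translate]
    exact G.det _ huv1
  have hincl : Tendsto (fun x : Fin n → ℂ => (x, v1)) (𝓝 u1) (𝓝 (u1, v1)) :=
    (Continuous.prodMk_left v1).tendsto u1
  have hrelx : ∀ k, ∀ᶠ x in 𝓝 u1, Qe (Q k) (fun s => ξ s (x, v1)) (ψ k x) = 0 := fun k =>
    hincl.eventually (hrel1 k)
  -- claim A
  have hA : ∀ k, AG (ψ k) φ u1 := by
    intro k
    let sub : Option (Fin n ⊕ Fin n) → MvPolynomial (Option (Fin n)) ℂ := fun o =>
      o.elim (X none) (Sum.elim (fun j => X (some j)) fun j => C (φ j v1))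
    have hsub : ∀ (x : Fin n → ℂ) (y : ℂ), eval (fun i : Option (Fin n) => i.elim y fun j => x j)
        (bind₁ sub ((optionEquivLeft ℂ _).symm (Q k))) = Qe (Q k) (Sum.elim x fun j => φ j v1) y := by
      intro x y
      rw [Qe_opt]
      change eval₂Hom _ _ _ = _
      rw [eval₂Hom_bind₁]
      change eval _ _ = _
      congr 2
      funext o
      rcases o with _ | (j | j) <;> simp [sub]
    refine ⟨bind₁ sub ((optionEquivLeft ℂ _).symm (Q k)), ?_, ?_⟩
    · intro h0
      have hz : ∀ y, Qe (Q k) (fun s => ξ s (u1, v1)) y = 0 := by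
        intro y
        have := hsub (fun j => φ j u1) y
        rw [h0, map_zero] at this
        exact this.symm
      have hp0 : (Q k).map (eval fun s => ξ s (u1, v1)) = 0 := by
        apply Polynomial.funext
        intro y
        rw [Polynomial.eval_zero]
        exact hz y
      have := congrArg (fun P => Qe P (fun s => ξ s (u1, v1)) 0) (hQ k)
      simp only [Qe_add, Qe_mul, Qe_C] at this
      apply hD1 k
      rw [← this]
      simp [Qe, ← Polynomial.derivative_map, hp0]
    · filter_upwards [hrelx k] with x hx
      rw [hsub]; exact hx
  -- claim B
  have hB : ∀ k p, AG (fun x => pd (φ k) p (x + v1)) φ u1 := by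
    intro k p
    have hζ : AnalyticAt ℂ (fun x => pd (φ k) p (x + v1)) u1 :=
      (pd_analytic (G.an huv1 k) p).fun_comp_of_eq (tr _) rfl
    rw [AG_iff hζ (G.an hu1) hφi]
    let S := Subalgebra.algebraicClosure (Algebra.adjoin ℂ (Set.range fun k => gm (φ k) (G.an hu1 k))) (AnField u1)
    have hS : ∀ z, z ∈ S ↔ IsAlgebraic (Algebra.adjoin ℂ (Set.range fun k => gm (φ k) (G.an hu1 k))) z := fun z => Iff.rfl
    let Θ : Option (Fin n ⊕ Fin n) → (Fin n → ℂ) → ℂ := fun o x =>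
      o.elim (ψ k x) fun s => ξ s (x, v1)
    have hΘ : ∀ o, AnalyticAt ℂ (Θ o) u1 := by
      rintro (_ | j | j)
      · exact hψ k
      · exact G.an hu1 j
      · exact (analyticAt_const : AnalyticAt ℂ (fun _ : Fin n → ℂ => φ j v1) u1)
    have hΘS : ∀ o, gm (Θ o) (hΘ o) ∈ S := by
      rintro (_ | j | j)
      · exact (AG_iff (hψ k) (G.an hu1) hφi).1 (hA k)
      · rw [hS]
        exact isAlgebraic_algebraMap (R := Algebra.adjoin ℂ (Set.range fun k => gm (φ k) (G.an hu1 k)))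
          (A := AnField u1) ⟨_, Algebra.subset_adjoin ⟨j, rfl⟩⟩
      · have : gm (Θ (some (Sum.inr j))) (hΘ (some (Sum.inr j))) = algebraMap ℂ (AnField u1) (φ j v1) := by
          rw [← (gmHom u1).commutes]; rfl
        rw [this, hS]
        exact isAlgebraic_algebraMap (R := Algebra.adjoin ℂ (Set.range fun k => gm (φ k) (G.an hu1 k)))
          (A := AnField u1) (algebraMap ℂ _ (φ j v1))
    have hev : ∀ P : MvPolynomial (Option (Fin n ⊕ Fin n)) ℂ,
        gm (fun x => eval (fun t => Θ t x) P) (eval_analytic hΘ P) ∈ S := by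
      intro P
      rw [← aeval_gm]
      have : aeval (fun t => gm (Θ t) (hΘ t)) P ∈ (S.restrictScalars ℂ) := by
        have h1 : Algebra.adjoin ℂ (Set.range fun t => gm (Θ t) (hΘ t)) ≤ S.restrictScalars ℂ := by
          rw [Algebra.adjoin_le_iff]
          rintro _ ⟨t, rfl⟩
          exact hΘS t
        apply h1
        rw [Algebra.adjoin_range_eq_range_aeval]
        exact ⟨P, rfl⟩
      exact this
    let Gp := (optionEquivLeft ℂ (Fin n ⊕ Fin n)).symm (Q k)
    let N : MvPolynomial (Option (Fin n ⊕ Fin n)) ℂ :=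
      ∑ l, pderiv (some (Sum.inr l)) Gp * C (pd (φ l) p v1)
    have hmain : ∀ᶠ x in 𝓝 u1, eval (fun t => Θ t x) (pderiv none Gp) * pd (φ k) p (x + v1) =
        - eval (fun t => Θ t x) N := by
      have e1 := hincl.eventually (hrel1 k).eventually_nhds
      have e2 : ∀ᶠ x in 𝓝 u1, H (x + v1) ≠ 0 :=
        (cH.comp (continuous_id.add continuous_const)).continuousAt.eventually_ne huv1
      filter_upwards [e1, e2] with x hx hxv
      have hd := eval_hasDerivAt Gp (s := 0)
        (θ := fun o s => o.elim (φ k (x + v1 + s • Pi.single p 1))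
          fun t => ξ t (x, v1 + s • Pi.single p 1))
        (θ' := fun o => o.elim (pd (φ k) p (x + v1)) (Sum.elim (fun _ => 0) fun l => pd (φ l) p v1))
        (by
          rintro (_ | j | j)
          · exact pd_line (G.an hxv k) p
          · exact hasDerivAt_const (0:ℂ) (φ j x)
          · exact pd_line (G.an hv1 j) p)
      have hzero : (fun s : ℂ => eval (fun o : Option (Fin n ⊕ Fin n) => o.elim (φ k (x + v1 + s • Pi.single p 1))
          fun t => ξ t (x, v1 + s • Pi.single p 1)) Gp) =ᶠ[𝓝 0] fun _ => 0 := by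
        have ht : Tendsto (fun s : ℂ => (x, v1 + s • (Pi.single p 1 : Fin n → ℂ))) (𝓝 0) (𝓝 (x, v1)) := by
          have : Continuous (fun s : ℂ => (x, v1 + s • (Pi.single p 1 : Fin n → ℂ))) := by fun_prop
          simpa using this.tendsto 0
        filter_upwards [ht.eventually hx] with s hs
        rw [Qe_opt] at hs
        rw [add_assoc]
        exact hs
      have h0 := (hd.congr_of_eventuallyEq hzero.symm).unique (hasDerivAt_const (0:ℂ) (0:ℂ))
      simp only [Fintype.sum_option, Fintype.sum_sum_type, zero_smul, add_zero, Option.elim, Sum.elim_inl,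
        Sum.elim_inr, mul_zero, Finset.sum_const_zero, zero_add] at h0
      have h1 : eval (fun t => Θ t x) N = ∑ l, eval (fun t => Θ t x) (pderiv (some (Sum.inr l)) Gp) * pd (φ l) p v1 := by
        simp only [N, map_sum, map_mul, eval_C]
      rw [h1]
      exact eq_neg_of_add_eq_zero_left h0
    have hne : gm (fun x => eval (fun t => Θ t x) (pderiv none Gp)) (eval_analytic hΘ _) ≠ 0 := by
      intro h0
      rw [gm_eq_zero] at h0
      have h1 := h0.self_of_nhds
      have h2 : Qe (Polynomial.derivative (Q k)) (fun s => ξ s (u1, v1)) (ψ k u1) = 0 := by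
        rw [← pderiv_none_Qe]; exact h1
      have h3 := (hrelx k).self_of_nhds
      have := congrArg (fun P => Qe P (fun s => ξ s (u1, v1)) (ψ k u1)) (hQ k)
      simp only [Qe_add, Qe_mul, Qe_C, h2, h3, mul_zero, add_zero] at this
      exact hD1 k this.symm
    have hgm : gm (fun x => eval (fun t => Θ t x) (pderiv none Gp)) (eval_analytic hΘ _) *
        gm (fun x => pd (φ k) p (x + v1)) hζ = gm (fun x => eval (fun t => Θ t x) (-N)) (eval_analytic hΘ _) := by
      rw [gm_mul]
      apply gm_congr
      filter_upwards [hmain] with x hx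
      rw [hx, map_neg]
    have hfin : gm (fun x => pd (φ k) p (x + v1)) hζ =
        (gm (fun x => eval (fun t => Θ t x) (pderiv none Gp)) (eval_analytic hΘ _))⁻¹ *
        gm (fun x => eval (fun t => Θ t x) (-N)) (eval_analytic hΘ _) := by
      rw [← hgm, ← mul_assoc, inv_mul_cancel₀ hne, one_mul]
    rw [hfin]
    exact S.mul_mem (((hS _).1 (hev _)).inv) (hev _)
  refine ⟨u1 + v1, huv1, fun k p => ?_⟩
  obtain ⟨T, hT0, hT⟩ := AG_exchange (θ := fun x => pd (φ k) p (x + v1))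
    ((pd_analytic (G.an huv1 k) p).fun_comp_of_eq (tr _) rfl) (G.an hu1) hψ hφi hψi hA (hB k p)
  refine ⟨T, hT0, ?_⟩
  have ht : Tendsto (fun y : Fin n → ℂ => y - v1) (𝓝 (u1 + v1)) (𝓝 u1) := by
    have : Continuous (fun y : Fin n → ℂ => y - v1) := by fun_prop
    simpa using this.tendsto (u1 + v1)
  filter_upwards [ht.eventually hT] with y hy
  simpa [ψ] using hy

end DerivAlg

open MvPolynomial Filter Topology

section Branches

variable {n : ℕ}

/-- the separable relations for the inverse Jacobian -/
structure RelData (φ : Fin n → (Fin n → ℂ) → ℂ) (H : (Fin n → ℂ) → ℂ)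
    (Q : Fin n → Fin n → Polynomial (MvPolynomial (Fin n) ℂ)) (D : MvPolynomial (Fin n) ℂ) : Prop where
  hD : D ≠ 0
  sep : ∀ i k, ∃ A B, A * Q i k + B * Polynomial.derivative (Q i k) = Polynomial.C D
  lc : ∀ i k, (Q i k).leadingCoeff ∣ D
  rel : ∀ u, H u ≠ 0 → ∀ i k, Qe (Q i k) (fun j => φ j u) (invJ φ i k u) = 0

lemma exists_rel {φ g h : Fin n → (Fin n → ℂ) → ℂ} {H : (Fin n → ℂ) → ℂ} (G : Good φ g h H)
    (haat : AdmitsAAT φ) : ∃ Q D, RelData φ H Q D := by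
  obtain ⟨u, hu, hAG⟩ := deriv_AG G haat
  have hI := fun i k => invJ_AG (G.an hu) (G.det u hu) hAG i k
  have hsep := fun i k => sep_rel (G.an hu) (G.indep hu) (invJ_analytic (G.an hu) (G.det u hu) i k) (hI i k)
  choose Q A B D hD hQ hl hrel using hsep
  have hdvd : ∀ i k, D i k ∣ ∏ i, ∏ k, D i k := fun i k =>
    (Finset.dvd_prod_of_mem (fun k => D i k) (Finset.mem_univ k)).trans
      (Finset.dvd_prod_of_mem (fun i => ∏ k, D i k) (Finset.mem_univ i))
  refine ⟨Q, ∏ i, ∏ k, D i k, ?_, ?_, fun i k => (hl i k).trans (hdvd i k), ?_⟩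
  · exact Finset.prod_ne_zero_iff.2 fun i _ => Finset.prod_ne_zero_iff.2 fun k _ => hD i k
  · intro i k
    obtain ⟨c, hc⟩ := hdvd i k
    refine ⟨Polynomial.C c * A i k, Polynomial.C c * B i k, ?_⟩
    rw [hc, map_mul, ← hQ i k]; ring
  · intro v hv i k
    exact ent_ident G.hH (F := fun u => Qe (Q i k) (fun j => φ j u) (invJ φ i k u))
      (fun u hu => Qe_analytic _ (G.an hu) (invJ_analytic (G.an hu) (G.det u hu) i k)) hu (hrel i k) hv

/-- a local branch of the inverse of `Φ` -/
def Branch (g h : Fin n → (Fin n → ℂ) → ℂ) (H : (Fin n → ℂ) → ℂ) (w : (Fin n → ℂ) → Fin n → ℂ)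
    (x : Fin n → ℂ) : Prop :=
  AnalyticAt ℂ w x ∧ (∀ᶠ y in 𝓝 x, ∀ k, g k (w y) = y k * h k (w y)) ∧ ∃ᶠ y in 𝓝 x, H (w y) ≠ 0

lemma Branch.congr {g h : Fin n → (Fin n → ℂ) → ℂ} {H : (Fin n → ℂ) → ℂ} {w w' : (Fin n → ℂ) → Fin n → ℂ}
    {x : Fin n → ℂ} (hw : Branch g h H w x) (he : w =ᶠ[𝓝 x] w') : Branch g h H w' x := by
  refine ⟨hw.1.congr he, ?_, ?_⟩
  · filter_upwards [hw.2.1, he] with y hy hy'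
    rwa [← hy']
  · refine (hw.2.2.and_eventually he).mono ?_
    rintro y ⟨h1, h2⟩
    rwa [← h2]

variable {φ g h : Fin n → (Fin n → ℂ) → ℂ} {H : (Fin n → ℂ) → ℂ}

lemma inv_at (G : Good φ g h H) {w : (Fin n → ℂ) → Fin n → ℂ} {x : Fin n → ℂ} (hw : AnalyticAt ℂ w x)
    (he : ∀ᶠ y in 𝓝 x, ∀ k, g k (w y) = y k * h k (w y)) (hx : H (w x) ≠ 0) :
    (∀ᶠ y in 𝓝 x, ∀ k, φ k (w y) = y k) ∧
    (Matrix.of fun k p => pd (φ k) p (w x)) * (Matrix.of fun i k => pd (fun y => w y i) k x) = 1 := by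
  have h1 : ∀ᶠ y in 𝓝 x, H (w y) ≠ 0 :=
    ((G.hH (w x)).continuousAt.comp hw.continuousAt).eventually_ne hx
  have h2 : ∀ᶠ y in 𝓝 x, ∀ k, φ k (w y) = y k := by
    filter_upwards [h1, he] with y hy hy' k
    have := G.hk _ hy k
    rw [G.phi k _ this, hy' k]; field_simp
  refine ⟨h2, ?_⟩
  ext k q
  have h3 : (fun y => φ k (w y)) =ᶠ[𝓝 x] fun y => y k := by
    filter_upwards [h2] with y hy using hy k
  have h4 : HasFDerivAt (fun y => φ k (w y)) ((fderiv ℂ (φ k) (w x)).comp (fderiv ℂ w x)) x :=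
    (G.an hx k).differentiableAt.hasFDerivAt.comp x hw.differentiableAt.hasFDerivAt
  have h5 : HasFDerivAt (fun y : Fin n → ℂ => y k) (ContinuousLinearMap.proj (R := ℂ) (φ := fun _ : Fin n => ℂ) k) x :=
    (ContinuousLinearMap.proj (R := ℂ) (φ := fun _ : Fin n => ℂ) k).hasFDerivAt
  have h6 := (h4.congr_of_eventuallyEq h3.symm).unique h5
  have h7 := DFunLike.congr_fun h6 (Pi.single q 1)
  have h8 : ∀ i, pd (fun y => w y i) q x = fderiv ℂ w x (Pi.single q 1) i := by
    intro i
    have : HasFDerivAt (fun y => w y i) ((ContinuousLinearMap.proj i).comp (fderiv ℂ w x)) x :=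
        (ContinuousLinearMap.proj (R := ℂ) (φ := fun _ : Fin n => ℂ) i).hasFDerivAt.comp x
          hw.differentiableAt.hasFDerivAt
    unfold pd
    rw [this.fderiv]; rfl
  rw [Matrix.mul_apply]
  simp only [Matrix.of_apply, h8]
  set v := fderiv ℂ w x (Pi.single q 1) with hv
  have h9 : fderiv ℂ (φ k) (w x) v = ∑ p, pd (φ k) p (w x) * v p := by
    conv_lhs => rw [pi_eq_sum_univ' v]
    rw [map_sum]
    refine Finset.sum_congr rfl fun p _ => ?_
    rw [map_smul, smul_eq_mul, mul_comm]
    congr 2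
  rw [← h9]
  have h10 : fderiv ℂ (φ k) (w x) v = (Pi.single q 1 : Fin n → ℂ) k := h7
  rw [h10, Matrix.one_apply, Pi.single_apply]

lemma branch_root (G : Good φ g h H) {Q : Fin n → Fin n → Polynomial (MvPolynomial (Fin n) ℂ)}
    {D : MvPolynomial (Fin n) ℂ} (R : RelData φ H Q D) {w : (Fin n → ℂ) → Fin n → ℂ} {x : Fin n → ℂ}
    (hw : Branch g h H w x) :
    ∀ᶠ y in 𝓝 x, ∀ i k, Qe (Q i k) y (pd (fun y => w y i) k y) = 0 := by
  rw [eventually_all]; intro i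
  rw [eventually_all]; intro k
  obtain ⟨hwa, he, hf⟩ := hw
  have hwi : AnalyticAt ℂ (fun y => w y i) x := analyticAt_pi_iff.1 hwa i
  have hF : AnalyticAt ℂ (fun y : Fin n → ℂ => Qe (Q i k) (fun j => y j) (pd (fun y => w y i) k y)) x :=
    Qe_analytic _ (fun j => (ContinuousLinearMap.proj (R := ℂ) (φ := fun _ : Fin n => ℂ) j).analyticAt x) (pd_analytic hwi k)
  have hHw : AnalyticAt ℂ (fun y => H (w y)) x := (G.hH _).fun_comp hwa
  have hprod : ∀ᶠ y in 𝓝 x, H (w y) * Qe (Q i k) (fun j => y j) (pd (fun y => w y i) k y) = 0 := by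
    filter_upwards [hwa.eventually_analyticAt, he.eventually_nhds] with y hy1 hy2
    by_cases hy : H (w y) = 0
    · rw [hy, zero_mul]
    · obtain ⟨h1, h2⟩ := inv_at G hy1 hy2 hy
      have h3 := Matrix.inv_eq_right_inv h2
      have h4 : invJ φ i k (w y) = pd (fun y => w y i) k y := by
        unfold invJ; rw [h3]; rfl
      have h5 := R.rel (w y) hy i k
      rw [h4] at h5
      have h6 : (fun j => φ j (w y)) = fun j => y j := funext h1.self_of_nhds
      rw [h6] at h5
      rw [h5, mul_zero]
  rcases anal_mul_ev hHw hF hprod with h | h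
  · exact absurd h (fun h => hf (h.mono fun y hy => not_not.2 hy))
  · exact h

end Branches

open MvPolynomial Filter Topology

section Roots
open scoped ContDiff

variable {σ : Type*} [Fintype σ]

lemma ev_ne {X : Type*} [TopologicalSpace X] {f g : X → ℂ} {x : X} (hf : ContinuousAt f x)
    (hg : ContinuousAt g x) (h : f x ≠ g x) : ∀ᶠ z in 𝓝 x, f z ≠ g z :=
  ((hf.sub hg).eventually_ne (sub_ne_zero.2 h)).mono fun _ hz => sub_ne_zero.1 hz

lemma Qe_analytic_prod (Q : Polynomial (MvPolynomial σ ℂ)) (u : (σ → ℂ) × ℂ) :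
    AnalyticAt ℂ (fun z : (σ → ℂ) × ℂ => Qe Q z.1 z.2) u :=
  Qe_analytic Q (θ := fun j (z : (σ → ℂ) × ℂ) => z.1 j)
    (fun j => (((ContinuousLinearMap.proj (R := ℂ) (φ := fun _ : σ => ℂ) j).comp
      (ContinuousLinearMap.fst ℂ (σ → ℂ) ℂ)).analyticAt u))
    ((ContinuousLinearMap.snd ℂ (σ → ℂ) ℂ).analyticAt u)

lemma root_fun (Q : Polynomial (MvPolynomial σ ℂ)) (x : σ → ℂ) (y : ℂ) (h0 : Qe Q x y = 0)
    (h1 : Qe (Polynomial.derivative Q) x y ≠ 0) :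
    ∃ ρ : (σ → ℂ) → ℂ, AnalyticAt ℂ ρ x ∧ ρ x = y ∧ ∀ᶠ z in 𝓝 x, Qe Q z (ρ z) = 0 := by
  set f : (σ → ℂ) × ℂ → ℂ := fun z => Qe Q z.1 z.2 with hf
  have hfa : AnalyticAt ℂ f (x, y) := Qe_analytic_prod Q (x, y)
  have hcd : ContDiffAt ℂ ω f (x, y) := hfa.contDiffAt
  have hc : (fderiv ℂ f (x, y) ∘L .inr ℂ (σ → ℂ) ℂ) 1 = Qe (Polynomial.derivative Q) x y := by
    have e1 : HasFDerivAt (fun t : ℂ => (x, t)) (ContinuousLinearMap.inr ℂ (σ → ℂ) ℂ) y :=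
      hasFDerivAt_prodMk_right x y
    have e2 : HasFDerivAt (fun t : ℂ => f (x, t)) (fderiv ℂ f (x, y) ∘L .inr ℂ (σ → ℂ) ℂ) y :=
      (hfa.differentiableAt.hasFDerivAt).comp y e1
    have e3 : HasDerivAt (fun t : ℂ => f (x, t)) (Qe (Polynomial.derivative Q) x y) y := by
      have := (Q.map (eval x)).hasDerivAt y
      rw [Polynomial.derivative_map] at this
      exact this
    rw [e2.unique e3.hasFDerivAt]
    simp
  have hinv : (fderiv ℂ f (x, y) ∘L .inr ℂ (σ → ℂ) ℂ).IsInvertible := by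
    refine ⟨ContinuousLinearEquiv.unitsEquivAut ℂ (Units.mk0 _ h1), ?_⟩
    ext
    rw [hc]
    simp
  have hp : (ω : WithTop ℕ∞) ≠ 0 := by simp
  refine ⟨hcd.implicitFunction hp hinv, ?_, hcd.implicitFunction_apply_self hp hinv, ?_⟩
  · exact (hcd.contDiffAt_implicitFunction hp hinv).analyticAt
  · have := hcd.eventually_apply_implicitFunction hp hinv
    filter_upwards [this] with z hz
    have h2 : f (x, y) = 0 := h0
    rw [h2] at hz
    exact hz

lemma roots_local (Q : Polynomial (MvPolynomial σ ℂ)) (D : MvPolynomial σ ℂ)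
    (sep : ∃ A B, A * Q + B * Polynomial.derivative Q = Polynomial.C D)
    (lc : Q.leadingCoeff ∣ D) (x : σ → ℂ) (hx : eval x D ≠ 0) :
    ∃ (r : Finset ℂ) (ρ : ℂ → (σ → ℂ) → ℂ), r.card = Q.natDegree ∧ ∀ᶠ z in 𝓝 x, (∀ a ∈ r, AnalyticAt ℂ (ρ a) z) ∧
      (∀ y, Qe Q z y = 0 ↔ ∃ a ∈ r, y = ρ a z) ∧ ∀ a ∈ r, ∀ b ∈ r, a ≠ b → ρ a z ≠ ρ b z := by
  classical
  obtain ⟨A, B, hAB⟩ := sep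
  obtain ⟨c, hc⟩ := lc
  have hlc : ∀ z, eval z D ≠ 0 → eval z Q.leadingCoeff ≠ 0 := by
    intro z hz h
    rw [hc, map_mul, h, zero_mul] at hz; exact hz rfl
  have hdeg : ∀ z, eval z D ≠ 0 → (Q.map (eval z)).natDegree = Q.natDegree :=
    fun z hz => Polynomial.natDegree_map_of_leadingCoeff_ne_zero _ (hlc z hz)
  have hne : ∀ z, eval z D ≠ 0 → Q.map (eval z) ≠ 0 := by
    intro z hz h
    have := hlc z hz
    rw [← Polynomial.leadingCoeff_map_of_leadingCoeff_ne_zero _ this, h] at this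
    simp at this
  have hder : ∀ y, Qe Q x y = 0 → Qe (Polynomial.derivative Q) x y ≠ 0 := by
    intro y h0 h1
    have := congrArg (fun P => Qe P x y) hAB
    simp only [Qe_add, Qe_mul, Qe_C, h0, h1, mul_zero, add_zero] at this
    exact hx this.symm
  have hsep : (Q.map (eval x)).Separable := by
    have h2 := congrArg (Polynomial.map (eval x)) hAB
    rw [Polynomial.map_add, Polynomial.map_mul, Polynomial.map_mul, Polynomial.map_C] at h2
    refine ⟨Polynomial.C (eval x D)⁻¹ * A.map (eval x), Polynomial.C (eval x D)⁻¹ * B.map (eval x), ?_⟩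
    rw [mul_assoc, mul_assoc, ← mul_add, Polynomial.derivative_map, h2, ← Polynomial.C_mul,
      inv_mul_cancel₀ hx, Polynomial.C_1]
  let r : Finset ℂ := (Q.map (eval x)).roots.toFinset
  have hr : ∀ a, a ∈ r ↔ Qe Q x a = 0 := by
    intro a
    simp only [r, Multiset.mem_toFinset, Polynomial.mem_roots (hne x hx)]
    rfl
  have hcard : r.card = Q.natDegree := by
    rw [Multiset.toFinset_card_of_nodup (Polynomial.nodup_roots hsep),
      ← Polynomial.Splits.natDegree_eq_card_roots (IsAlgClosed.splits _), hdeg x hx]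
  have hex : ∀ a : ℂ, ∃ ρ : (σ → ℂ) → ℂ, a ∈ r → AnalyticAt ℂ ρ x ∧ ρ x = a ∧ ∀ᶠ z in 𝓝 x, Qe Q z (ρ z) = 0 := by
    intro a
    by_cases ha : a ∈ r
    · obtain ⟨ρ, h⟩ := root_fun Q x a ((hr a).1 ha) (hder a ((hr a).1 ha))
      exact ⟨ρ, fun _ => h⟩
    · exact ⟨0, fun h => absurd h ha⟩
  choose ρ hρ using hex
  refine ⟨r, ρ, hcard, ?_⟩
  have e1 : ∀ᶠ z in 𝓝 x, ∀ a ∈ r, AnalyticAt ℂ (ρ a) z :=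
    (Filter.eventually_all_finset r).2 fun a ha => (hρ a ha).1.eventually_analyticAt
  have e2 : ∀ᶠ z in 𝓝 x, ∀ a ∈ r, Qe Q z (ρ a z) = 0 :=
    (Filter.eventually_all_finset r).2 fun a ha => (hρ a ha).2.2
  have e3 : ∀ᶠ z in 𝓝 x, ∀ a ∈ r, ∀ b ∈ r, a ≠ b → ρ a z ≠ ρ b z := by
    refine (Filter.eventually_all_finset r).2 fun a ha => (Filter.eventually_all_finset r).2 fun b hb => ?_
    by_cases hab : a = b
    · exact Eventually.of_forall fun z h => absurd hab h
    · have : ∀ᶠ z in 𝓝 x, ρ a z ≠ ρ b z :=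
        ev_ne (hρ a ha).1.continuousAt (hρ b hb).1.continuousAt
          (by rw [(hρ a ha).2.1, (hρ b hb).2.1]; exact hab)
      exact this.mono fun z hz _ => hz
  have e4 : ∀ᶠ z in 𝓝 x, eval z D ≠ 0 :=
    (MvPolynomial.continuous_eval D).continuousAt.eventually_ne hx
  filter_upwards [e1, e2, e3, e4] with z h1 h2 h3 h4
  refine ⟨h1, ?_, h3⟩
  have hsub : r.image (fun a => ρ a z) ⊆ (Q.map (eval z)).roots.toFinset := by
    intro y hy
    obtain ⟨a, ha, rfl⟩ := Finset.mem_image.1 hy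
    rw [Multiset.mem_toFinset, Polynomial.mem_roots (hne z h4)]
    exact h2 a ha
  have heq := Finset.eq_of_subset_of_card_le hsub (by
    rw [Finset.card_image_of_injOn (fun a ha b hb hab => by
      by_contra hne'; exact h3 a ha b hb hne' hab), hcard]
    refine (Multiset.toFinset_card_le _).trans ((Polynomial.card_roots' _).trans ?_)
    rw [hdeg z h4])
  intro y
  constructor
  · intro hy
    have : y ∈ (Q.map (eval z)).roots.toFinset := by
      rw [Multiset.mem_toFinset, Polynomial.mem_roots (hne z h4)]; exact hy
    rw [← heq] at this
    obtain ⟨a, ha, e⟩ := Finset.mem_image.1 this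
    exact ⟨a, ha, e.symm⟩
  · rintro ⟨a, ha, rfl⟩
    exact h2 a ha

lemma root_unique {X : Type*} [TopologicalSpace X] {r : Finset ℂ} {ρ : ℂ → X → ℂ} {x : X}
    (hc : ∀ a ∈ r, ContinuousAt (ρ a) x) (hne : ∀ a ∈ r, ∀ b ∈ r, a ≠ b → ρ a x ≠ ρ b x)
    {f : X → ℂ} (hf : ContinuousAt f x) (hroot : ∀ᶠ z in 𝓝 x, ∃ a ∈ r, f z = ρ a z)
    {a : ℂ} (ha : a ∈ r) (hfa : f x = ρ a x) : f =ᶠ[𝓝 x] ρ a := by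
  have h1 : ∀ᶠ z in 𝓝 x, ∀ b ∈ r, b ≠ a → f z ≠ ρ b z := by
    refine (Filter.eventually_all_finset r).2 fun b hb => ?_
    by_cases hab : b = a
    · exact Eventually.of_forall fun z h => absurd hab h
    · have : ∀ᶠ z in 𝓝 x, f z ≠ ρ b z :=
        ev_ne hf (hc b hb) (by rw [hfa]; exact hne a ha b hb (Ne.symm hab))
      exact this.mono fun z hz _ => hz
  filter_upwards [h1, hroot] with z hz ⟨b, hb, hz'⟩
  by_cases hab : b = a
  · rw [hz', hab]
  · exact absurd hz' (hz b hb hab)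

end Roots

open MvPolynomial Filter Topology

section Prim
open scoped ENNReal NNReal
variable {E : Type*} [NormedAddCommGroup E] [NormedSpace ℂ E]

lemma prim_analytic {f : E → ℂ} {ω : E → E →L[ℂ] ℂ} {x : E} (hω : AnalyticAt ℂ ω x)
    (hf : ∀ᶠ y in 𝓝 x, HasFDerivAt f (ω y) y) : AnalyticAt ℂ f x := by
  obtain ⟨p, r, hp⟩ := hω
  obtain ⟨ε, hε, hfε⟩ := Metric.eventually_nhds_iff_ball.1 hf
  obtain ⟨ρ, hρ0, hρ⟩ := ENNReal.lt_iff_exists_nnreal_btwn.1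
    (lt_min hp.r_pos (ENNReal.ofReal_pos.2 hε))
  have hρ0' : (0 : ℝ) < ρ := by exact_mod_cast hρ0
  have hρr : (ρ : ℝ≥0∞) < r := hρ.trans_le (min_le_left _ _)
  have hρε : (ρ : ℝ) < ε := by
    have := hρ.trans_le (min_le_right _ _)
    rw [← ENNReal.ofReal_coe_nnreal, ENNReal.ofReal_lt_ofReal_iff hε] at this
    exact this
  have hρp : (ρ : ℝ≥0∞) < p.radius := hρr.trans_le hp.r_le
  let q : FormalMultilinearSeries ℂ E ℂ := fun n => (n : ℂ)⁻¹ • (p.unshift 0) n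
  obtain ⟨C, hC, hCn⟩ := p.norm_mul_pow_le_of_lt_radius hρp
  have hq : HasFPowerSeriesOnBall (fun y => f y - f x) q x ρ := by
    refine ⟨?_, hρ0, ?_⟩
    · refine q.le_radius_of_bound (C * ρ) fun n => ?_
      rcases n with _ | n
      · simp [q]; positivity
      · have h1 : ‖q (n+1)‖ ≤ ‖p n‖ := by
          simp only [q]
          rw [norm_smul, norm_inv, Complex.norm_natCast]
          have : ‖(p.unshift 0) (n+1)‖ = ‖p n‖ := ContinuousMultilinearMap.uncurryRight_norm _
          rw [this]
          refine mul_le_of_le_one_left (norm_nonneg _) (inv_le_one_of_one_le₀ ?_)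
          push_cast; linarith [(Nat.cast_nonneg n : (0:ℝ) ≤ n)]
        calc ‖q (n+1)‖ * (ρ:ℝ)^(n+1) ≤ ‖p n‖ * (ρ:ℝ)^(n+1) := by gcongr
          _ = ‖p n‖ * (ρ:ℝ)^n * ρ := by ring
          _ ≤ C * ρ := by gcongr; exact hCn n
    · intro y hy
      have hy' : ‖y‖ < ρ := by simpa using hy
      let a : ℕ → ℂ := fun n => p n (fun _ => y) y
      have hin : ∀ s ∈ Set.uIcc (0:ℝ) 1, ‖(s:ℂ) • y‖ ≤ ‖y‖ := by
        intro s hs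
        rw [Set.uIcc_of_le zero_le_one] at hs
        rw [norm_smul, Complex.norm_real, Real.norm_eq_abs, abs_of_nonneg hs.1]
        exact mul_le_of_le_one_left (norm_nonneg _) hs.2
      have hser : ∀ s ∈ Set.uIcc (0:ℝ) 1, HasSum (fun n => (s:ℂ)^n * a n) (ω (x + (s:ℂ) • y) y) := by
        intro s hs
        have h1 := hp.hasSum (y := (s:ℂ) • y) (by
          have : ‖(s:ℂ) • y‖ < ρ := (hin s hs).trans_lt hy'
          refine lt_of_lt_of_le ?_ hρr.le
          rw [edist_zero_right, enorm_eq_nnnorm]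
          exact_mod_cast this)
        have h2 := h1.mapL (ContinuousLinearMap.apply ℂ ℂ y)
        have e : ∀ n, (s:ℂ)^n * a n = (ContinuousLinearMap.apply ℂ ℂ y) (p n fun _ => (s:ℂ) • y) := by
          intro n
          have := ContinuousMultilinearMap.map_smul_univ (p n) (fun _ => (s:ℂ)) (fun _ => y)
          rw [ContinuousLinearMap.apply_apply, this]
          simp only [Finset.prod_const, Finset.card_univ, Fintype.card_fin]
          rfl
        simp only [e]
        exact h2
      have hder : ∀ s ∈ Set.uIcc (0:ℝ) 1, HasDerivAt (fun s : ℝ => f (x + (s:ℂ) • y)) (ω (x + (s:ℂ) • y) y) s := by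
        intro s hs
        have h1 : HasFDerivAt f (ω (x + (s:ℂ) • y)) (x + (s:ℂ) • y) := hfε _ (by
          rw [Metric.mem_ball, dist_eq_norm, add_sub_cancel_left]
          exact ((hin s hs).trans_lt hy').trans hρε)
        have h2 : HasDerivAt (fun s : ℝ => x + (s:ℂ) • y) y s := by
          have := (((hasDerivAt_id s).ofReal_comp).smul_const y).const_add x
          simpa using this
        exact (h1.restrictScalars ℝ).comp_hasDerivAt s h2
      let F : ℕ → C(ℝ, ℂ) := fun n => ⟨fun s => (s:ℂ)^n * a n, by fun_prop⟩
      have hsumm : Summable fun n => ‖(F n).restrict (⟨Set.uIcc (0:ℝ) 1, isCompact_uIcc⟩ : TopologicalSpace.Compacts ℝ)‖ := by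
        refine Summable.of_nonneg_of_le (fun _ => norm_nonneg _) (fun n => ?_)
          ((p.summable_norm_mul_pow hρp).mul_right (ρ : ℝ))
        rw [ContinuousMap.norm_le _ (by positivity)]
        rintro ⟨s, hs⟩
        have hs' : s ∈ Set.Icc (0:ℝ) 1 := by rwa [← Set.uIcc_of_le zero_le_one]
        have : ‖(s:ℂ)^n * a n‖ ≤ ‖p n‖ * ρ ^ n * ρ := by
          rw [norm_mul, norm_pow, Complex.norm_real, Real.norm_eq_abs, abs_of_nonneg hs'.1]
          calc s ^ n * ‖a n‖ ≤ 1 * ‖a n‖ := by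
                gcongr; exact pow_le_one₀ hs'.1 hs'.2
            _ = ‖a n‖ := one_mul _
            _ ≤ ‖p n (fun _ => y)‖ * ‖y‖ := (p n fun _ => y).le_opNorm y
            _ ≤ (‖p n‖ * ‖y‖ ^ n) * ‖y‖ := by
                gcongr; simpa using (p n).le_opNorm (fun _ => y)
            _ ≤ _ := by gcongr
        exact this
      have hint := intervalIntegral.hasSum_intervalIntegral_of_summable_norm hsumm
      have hts : ∀ s ∈ Set.uIcc (0:ℝ) 1, ∑' n, F n s = ω (x + (s:ℂ) • y) y := fun s hs => (hser s hs).tsum_eq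
      have hcont : ContinuousOn (fun s : ℝ => ω (x + (s:ℂ) • y) y) (Set.uIcc 0 1) := by
        have h1 : ContinuousOn ω (Metric.eball x r) := hp.continuousOn
        have h2 : ContinuousOn (fun s : ℝ => ω (x + (s:ℂ) • y)) (Set.uIcc 0 1) := by
          refine h1.comp (by fun_prop) fun s hs => ?_
          have : ‖(s:ℂ) • y‖ < ρ := (hin s hs).trans_lt hy'
          refine lt_of_lt_of_le ?_ hρr.le
          rw [edist_eq_enorm_sub, add_sub_cancel_left, enorm_eq_nnnorm]
          exact_mod_cast this
        exact h2.clm_apply continuousOn_const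
      have hI : ∫ s in (0:ℝ)..1, ∑' n, F n s = f (x + y) - f x := by
        rw [intervalIntegral.integral_congr hts,
          intervalIntegral.integral_eq_sub_of_hasDerivAt hder hcont.intervalIntegrable]
        simp
      have hIn : ∀ n, ∫ s in (0:ℝ)..1, F n s = ((n+1 : ℕ) : ℂ)⁻¹ * a n := by
        intro n
        have : ∀ s : ℝ, F n s = (s:ℂ)^n * a n := fun _ => rfl
        simp only [this]
        rw [intervalIntegral.integral_mul_const]
        congr 1
        have := integral_pow (a := 0) (b := 1) n
        have h2 : ∫ s in (0:ℝ)..1, (s:ℂ)^n = ((∫ s in (0:ℝ)..1, s^n : ℝ) : ℂ) := by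
          rw [← intervalIntegral.integral_ofReal]; push_cast; rfl
        rw [h2, this]; push_cast; simp
      rw [hI] at hint
      simp only [hIn] at hint
      have hfin : HasSum (fun n => q (n+1) fun _ => y) (f (x+y) - f x) := by
        exact hint
      have := (hasSum_nat_add_iff' (f := fun n => q n fun _ => y) (g := f (x+y) - f x) 1).1 (by
        simpa [q] using hfin)
      exact this
  have h := hq.analyticAt.add (analyticAt_const (v := f x))
  refine h.congr (Eventually.of_forall fun y => ?_)
  simp

end Prim

open MvPolynomial Filter Topology

section Cont

variable {n : ℕ}

lemma fderiv_sum_pd (f : (Fin n → ℂ) → ℂ) (x : Fin n → ℂ) :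
    fderiv ℂ f x = ∑ k, pd f k x • ContinuousLinearMap.proj (R := ℂ) (φ := fun _ : Fin n => ℂ) k := by
  ext v
  conv_lhs => rw [pi_eq_sum_univ' v]
  rw [map_sum, sum_apply]
  refine Finset.sum_congr rfl fun p _ => ?_
  rw [map_smul, smul_eq_mul, mul_comm]
  rfl

lemma const_near {f f' : (Fin n → ℂ) → ℂ} {x : Fin n → ℂ} {ω : (Fin n → ℂ) → (Fin n → ℂ) →L[ℂ] ℂ}
    (hf : ∀ᶠ y in 𝓝 x, HasFDerivAt f (ω y) y) (hf' : ∀ᶠ y in 𝓝 x, HasFDerivAt f' (ω y) y) :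
    ∀ᶠ y in 𝓝 x, f y - f' y = f x - f' x := by
  obtain ⟨ε, hε, hb⟩ := Metric.eventually_nhds_iff_ball.1 (hf.and hf')
  have hd : ∀ y ∈ Metric.ball x ε, HasFDerivAt (fun y => f y - f' y) (0 : (Fin n → ℂ) →L[ℂ] ℂ) y := by
    intro y hy
    have := (hb y hy).1.sub (hb y hy).2
    rwa [sub_self] at this
  filter_upwards [Metric.ball_mem_nhds x hε] with y hy
  exact Metric.isOpen_ball.is_const_of_fderiv_eq_zero (𝕜 := ℂ) (convex_ball x ε).isPreconnected
    (fun z hz => (hd z hz).differentiableAt.differentiableWithinAt) (fun z hz => (hd z hz).fderiv) hy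
    (Metric.mem_ball_self hε)

variable {φ g h : Fin n → (Fin n → ℂ) → ℂ} {H : (Fin n → ℂ) → ℂ}

lemma cont_branch (G : Good φ g h H) {Q : Fin n → Fin n → Polynomial (MvPolynomial (Fin n) ℂ)}
    {D : MvPolynomial (Fin n) ℂ} (R : RelData φ H Q D) {x : Fin n → ℂ} (hx : eval x D ≠ 0) :
    ∃ ε > 0, (∀ z ∈ Metric.ball x ε, eval z D ≠ 0) ∧ ∀ x1 ∈ Metric.ball x ε, ∀ w, Branch g h H w x1 →
      ∃ w', (∀ z ∈ Metric.ball x ε, Branch g h H w' z) ∧ w' =ᶠ[𝓝 x1] w := by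
  have hloc := fun i k => roots_local (Q i k) D (R.sep i k) (R.lc i k) x hx
  choose r ρ hcard hev using hloc
  have e4 : ∀ᶠ z in 𝓝 x, eval z D ≠ 0 :=
    (MvPolynomial.continuous_eval D).continuousAt.eventually_ne hx
  have hev' := eventually_all.2 fun i => eventually_all.2 fun k => hev i k
  obtain ⟨ε, hε, hb⟩ := Metric.eventually_nhds_iff_ball.1 (e4.and hev')
  refine ⟨ε, hε, fun z hz => (hb z hz).1, fun x1 hx1 w hw => ?_⟩
  set B := Metric.ball x ε with hB
  have hBo : IsOpen B := Metric.isOpen_ball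
  have hBp : IsPreconnected B := (convex_ball x ε).isPreconnected
  have hroot := branch_root G R hw
  have hwi : ∀ i, AnalyticAt ℂ (fun y => w y i) x1 := analyticAt_pi_iff.1 hw.1
  have hch : ∀ i k, ∃ a ∈ r i k, pd (fun y => w y i) k x1 = ρ i k a x1 := fun i k =>
    (((hb x1 hx1).2 i k).2.1 _).1 (hroot.self_of_nhds i k)
  choose a ha hpa using hch
  have heq : ∀ i k, (fun y => pd (fun y => w y i) k y) =ᶠ[𝓝 x1] ρ i k (a i k) := by
    intro i k
    refine root_unique (r := r i k) (ρ := ρ i k) (fun b hb' => (((hb x1 hx1).2 i k).1 b hb').continuousAt)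
      ((hb x1 hx1).2 i k).2.2 (pd_analytic (hwi i) k).continuousAt ?_ (ha i k) (hpa i k)
    filter_upwards [hroot, hBo.mem_nhds hx1] with z hz hzB
    exact (((hb z hzB).2 i k).2.1 _).1 (hz i k)
  let ω : Fin n → (Fin n → ℂ) → (Fin n → ℂ) →L[ℂ] ℂ := fun i z =>
    ∑ k, ρ i k (a i k) z • ContinuousLinearMap.proj (R := ℂ) (φ := fun _ : Fin n => ℂ) k
  have hωa : ∀ i, ∀ z ∈ B, AnalyticAt ℂ (ω i) z := by
    intro i z hz
    refine Finset.analyticAt_fun_sum _ fun k _ => ?_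
    exact (((hb z hz).2 i k).1 _ (ha i k)).smul analyticAt_const
  have hwd : ∀ i, ∀ᶠ y in 𝓝 x1, HasFDerivAt (fun y => w y i) (ω i y) y := by
    intro i
    filter_upwards [(hwi i).eventually_analyticAt, eventually_all.2 (heq i)] with y hy1 hy2
    have := hy1.differentiableAt.hasFDerivAt
    rw [fderiv_sum_pd] at this
    simp only [hy2] at this
    exact this
  have hsymm : ∀ i, ∀ z ∈ B, ∀ u v, fderiv ℂ (ω i) z u v = fderiv ℂ (ω i) z v u := by
    intro i z hz u v
    have hK : AnalyticOnNhd ℂ (fun z => fderiv ℂ (ω i) z u v - fderiv ℂ (ω i) z v u) B := by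
      intro z hz
      have h1 : AnalyticAt ℂ (fderiv ℂ (ω i)) z := (hωa i z hz).fderiv
      have h2 : ∀ u v, AnalyticAt ℂ (fun z => fderiv ℂ (ω i) z u v) z := fun u v =>
        (((ContinuousLinearMap.apply ℂ ℂ v).comp
          (ContinuousLinearMap.apply ℂ ((Fin n → ℂ) →L[ℂ] ℂ) u)).analyticAt _).fun_comp h1
      exact (h2 u v).sub (h2 v u)
    have h0 : ∀ᶠ z in 𝓝 x1, fderiv ℂ (ω i) z u v - fderiv ℂ (ω i) z v u = 0 := by
      filter_upwards [(hwd i).eventually_nhds, hBo.mem_nhds hx1] with y hy hyB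
      rw [sub_eq_zero]
      exact second_derivative_symmetric_of_eventually (f := fun y => w y i) hy
        (hωa i y hyB).differentiableAt.hasFDerivAt u v
    exact sub_eq_zero.1 (hK.eqOn_zero_of_preconnected_of_eventuallyEq_zero hBp hx1 h0 hz)
  have hprim : ∀ i, ∃ f : (Fin n → ℂ) → ℂ, ∀ z ∈ B, HasFDerivAt f (ω i z) z := by
    intro i
    have hB' : Convex ℝ B := convex_ball x ε
    obtain ⟨f, hf⟩ := hB'.exists_forall_hasFDerivWithinAt_of_hasFDerivWithinAt_symmetric (ω := ω i)
      (dω := fun z => (fderiv ℂ (ω i) z).restrictScalars ℝ)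
      (fun z hz => ((hωa i z hz).differentiableAt.hasFDerivAt.restrictScalars ℝ).hasFDerivWithinAt)
      (fun z hz u _ v _ => hsymm i z hz u v)
    exact ⟨f, fun z hz => (hf z hz).hasFDerivAt (hBo.mem_nhds hz)⟩
  choose f hf using hprim
  have hfa : ∀ i, ∀ z ∈ B, AnalyticAt ℂ (f i) z := fun i z hz =>
    prim_analytic (hωa i z hz) (by filter_upwards [hBo.mem_nhds hz] with y hy using hf i y hy)
  let w' : (Fin n → ℂ) → Fin n → ℂ := fun z i => f i z - f i x1 + w x1 i
  have hw'a : AnalyticOnNhd ℂ w' B := fun z hz =>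
    analyticAt_pi_iff.2 fun i => ((hfa i z hz).sub analyticAt_const).add analyticAt_const
  have hw'eq : w' =ᶠ[𝓝 x1] w := by
    have : ∀ i, ∀ᶠ y in 𝓝 x1, w' y i = w y i := by
      intro i
      filter_upwards [const_near (f := f i) (f' := fun y => w y i)
        (by filter_upwards [hBo.mem_nhds hx1] with y hy using hf i y hy) (hwd i)] with y hy
      simp only [w']
      linear_combination hy
    filter_upwards [eventually_all.2 this] with y hy
    exact funext hy
  have hbr : Branch g h H w' x1 := hw.congr hw'eq.symm
  refine ⟨w', fun z hz => ⟨hw'a z hz, ?_, ?_⟩, hw'eq⟩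
  · have : ∀ k, ∀ y ∈ B, g k (w' y) - y k * h k (w' y) = 0 := by
      intro k y hy
      have hK : AnalyticOnNhd ℂ (fun y => g k (w' y) - y k * h k (w' y)) B := fun y hy =>
        ((G.hg k _).fun_comp (hw'a y hy)).sub
          (((ContinuousLinearMap.proj (R := ℂ) (φ := fun _ : Fin n => ℂ) k).analyticAt y).mul
            ((G.hh k _).fun_comp (hw'a y hy)))
      refine hK.eqOn_zero_of_preconnected_of_eventuallyEq_zero hBp hx1 ?_ hy
      filter_upwards [hbr.2.1] with y hy
      simp [hy k]
    filter_upwards [hBo.mem_nhds hz] with y hy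
    exact fun k => sub_eq_zero.1 (this k y hy)
  · intro hneg
    have hK : AnalyticOnNhd ℂ (fun y => H (w' y)) B := fun y hy => (G.hH _).fun_comp (hw'a y hy)
    have h0 := hK.eqOn_zero_of_preconnected_of_eventuallyEq_zero hBp hz
      (by filter_upwards [hneg] with y hy; simpa using hy)
    refine hbr.2.2 ?_
    filter_upwards [hBo.mem_nhds hx1] with y hy
    simpa using h0 hy

/-- Two branches with the same first derivatives at a good point differ by a constant. -/
lemma branch_diff (G : Good φ g h H) {Q : Fin n → Fin n → Polynomial (MvPolynomial (Fin n) ℂ)}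
    {D : MvPolynomial (Fin n) ℂ} (R : RelData φ H Q D) {x : Fin n → ℂ} (hx : eval x D ≠ 0)
    {w w' : (Fin n → ℂ) → Fin n → ℂ} (hw : Branch g h H w x) (hw' : Branch g h H w' x)
    (heq : ∀ i k, pd (fun y => w y i) k x = pd (fun y => w' y i) k x) :
    ∃ p, ∀ᶠ y in 𝓝 x, w' y = w y + p := by
  refine ⟨w' x - w x, ?_⟩
  have key : ∀ i, ∀ᶠ y in 𝓝 x, w' y i = w y i + (w' x - w x) i := by
    intro i
    have hwi : AnalyticAt ℂ (fun y => w y i) x := analyticAt_pi_iff.1 hw.1 i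
    have hwi' : AnalyticAt ℂ (fun y => w' y i) x := analyticAt_pi_iff.1 hw'.1 i
    have hk : ∀ k, ∀ᶠ y in 𝓝 x, pd (fun y => w y i) k y = pd (fun y => w' y i) k y := by
      intro k
      obtain ⟨r, ρ, -, hev⟩ := roots_local (Q i k) D (R.sep i k) (R.lc i k) x hx
      have h0 := hev.self_of_nhds
      obtain ⟨a, ha, hpa⟩ := (h0.2.1 _).1 ((branch_root G R hw).self_of_nhds i k)
      have t : ∀ {v : (Fin n → ℂ) → Fin n → ℂ}, Branch g h H v x → pd (fun y => v y i) k x = ρ a x →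
          (fun y => pd (fun y => v y i) k y) =ᶠ[𝓝 x] ρ a := by
        intro v hv hva
        refine root_unique (r := r) (fun b hb => (h0.1 b hb).continuousAt) h0.2.2
          (pd_analytic (analyticAt_pi_iff.1 hv.1 i) k).continuousAt ?_ ha hva
        filter_upwards [hev, branch_root G R hv] with z hz hz'
        exact (hz.2.1 _).1 (hz' i k)
      exact (t hw hpa).trans (t hw' ((heq i k).symm.trans hpa)).symm
    have hd : ∀ᶠ y in 𝓝 x, HasFDerivAt (fun y => w y i) (fderiv ℂ (fun y => w y i) y) y := by
      filter_upwards [hwi.eventually_analyticAt] with y hy using hy.differentiableAt.hasFDerivAt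
    have hd' : ∀ᶠ y in 𝓝 x, HasFDerivAt (fun y => w' y i) (fderiv ℂ (fun y => w y i) y) y := by
      filter_upwards [hwi'.eventually_analyticAt, eventually_all.2 hk] with y hy hy2
      have := hy.differentiableAt.hasFDerivAt
      rw [fderiv_sum_pd] at this ⊢
      simp only [hy2]
      exact this
    filter_upwards [const_near hd' hd] with y hy
    simp only [Pi.sub_apply]
    linear_combination hy
  filter_upwards [eventually_all.2 key] with y hy
  exact funext hy

end Cont

open MvPolynomial Filter Topology

section NP

variable {n : ℕ} {φ g h : Fin n → (Fin n → ℂ) → ℂ} {H : (Fin n → ℂ) → ℂ}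

/-- no nonzero common period -/
def NoPer (φ : Fin n → (Fin n → ℂ) → ℂ) (H : (Fin n → ℂ) → ℂ) : Prop :=
  ∀ p : Fin n → ℂ, (∀ k u, H u ≠ 0 → H (u + p) ≠ 0 → φ k (u + p) = φ k u) → p = 0

lemma np_unique (G : Good φ g h H) (np : NoPer φ H) {Q : Fin n → Fin n → Polynomial (MvPolynomial (Fin n) ℂ)}
    {D : MvPolynomial (Fin n) ℂ} (R : RelData φ H Q D) {x : Fin n → ℂ} (hx : eval x D ≠ 0)
    {w w' : (Fin n → ℂ) → Fin n → ℂ} (hw : Branch g h H w x) (hw' : Branch g h H w' x)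
    (heq : ∀ i k, pd (fun y => w y i) k x = pd (fun y => w' y i) k x) : w =ᶠ[𝓝 x] w' := by
  obtain ⟨p, hp⟩ := branch_diff G R hx hw hw' heq
  suffices hp0 : p = 0 by
    filter_upwards [hp] with y hy
    rw [hy, hp0, add_zero]
  refine np p ?_
  have hf : ∃ᶠ y in 𝓝 x, H (w y) ≠ 0 ∧ H (w' y) ≠ 0 := by
    intro hneg
    have := anal_mul_ev ((G.hH _).fun_comp hw.1) ((G.hH _).fun_comp hw'.1) (by
      filter_upwards [hneg] with y hy
      by_contra hc
      exact hy (mul_ne_zero_iff.1 hc))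
    rcases this with h1 | h1
    · exact hw.2.2 (h1.mono fun y hy => not_not.2 hy)
    · exact hw'.2.2 (h1.mono fun y hy => not_not.2 hy)
  obtain ⟨y, ⟨hy1, hy2⟩, hya, hya', hyr, hyr', hyp⟩ := (hf.and_eventually (hw.1.eventually_analyticAt.and
    (hw'.1.eventually_analyticAt.and (hw.2.1.eventually_nhds.and (hw'.2.1.eventually_nhds.and
      hp.eventually_nhds))))).exists
  obtain ⟨hφ, hJ⟩ := inv_at G hya hyr hy1
  obtain ⟨hφ', -⟩ := inv_at G hya' hyr' hy2
  have hdet : Matrix.det (Matrix.of fun i k => pd (fun y => w y i) k y) ≠ 0 := by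
    intro h0
    have := congrArg Matrix.det hJ
    rw [Matrix.det_mul, h0, mul_zero, Matrix.det_one] at this
    exact zero_ne_one this
  have hmap : map w (𝓝 y) = 𝓝 (w y) :=
    nhds_map_of_det (φ := fun i y => w y i) (analyticAt_pi_iff.1 hya) hdet
  have hper : ∀ k, ∀ᶠ u in 𝓝 (w y), φ k (u + p) - φ k u = 0 := by
    intro k
    rw [← hmap, eventually_map]
    filter_upwards [hφ, hφ', hyp] with z h1 h2 h3
    rw [← h3, h1 k, h2 k, sub_self]
  intro k u hu hu'
  have hadd : ∀ u, AnalyticAt ℂ (fun u : Fin n → ℂ => u + p) u := fun u => analyticAt_id.add analyticAt_const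
  have := ent_ident (H := fun u => H u * H (u + p)) (F := fun u => φ k (u + p) - φ k u)
    (fun u => (G.hH u).mul ((G.hH _).fun_comp (hadd u)))
    (fun u hu => (AnalyticAt.fun_comp (g := φ k) (f := fun u => u + p) (G.an (mul_ne_zero_iff.1 hu).2 k) (hadd u)).sub (G.an (mul_ne_zero_iff.1 hu).1 k))
    (u0 := w y) (mul_ne_zero hy1 (by rw [← hyp.self_of_nhds]; exact hy2)) (hper k) (u := u)
    (mul_ne_zero hu hu')
  exact sub_eq_zero.1 this

/-- the matrix of first derivatives -/
noncomputable def pdm (w : (Fin n → ℂ) → Fin n → ℂ) (x : Fin n → ℂ) : Fin n → Fin n → ℂ :=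
  fun i k => pd (fun y => w y i) k x

lemma pdm_congr {w w' : (Fin n → ℂ) → Fin n → ℂ} {x : Fin n → ℂ} (h : w =ᶠ[𝓝 x] w') : pdm w x = pdm w' x := by
  ext i k
  unfold pdm pd
  rw [Filter.EventuallyEq.fderiv_eq]
  filter_upwards [h] with y hy
  rw [hy]

lemma local_struct (G : Good φ g h H) (np : NoPer φ H) {Q : Fin n → Fin n → Polynomial (MvPolynomial (Fin n) ℂ)}
    {D : MvPolynomial (Fin n) ℂ} (R : RelData φ H Q D) {x : Fin n → ℂ} (hx : eval x D ≠ 0) :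
    ∃ (J : Finset (Fin n → Fin n → ℂ)) (w : (Fin n → Fin n → ℂ) → (Fin n → ℂ) → Fin n → ℂ),
      J.card ≤ ∏ i, ∏ k, (Q i k).natDegree ∧ ∀ᶠ z in 𝓝 x, eval z D ≠ 0 ∧ (∀ M ∈ J, Branch g h H (w M) z) ∧
      (∀ v, Branch g h H v z → ∃ M ∈ J, v =ᶠ[𝓝 z] w M) ∧
      ∀ M ∈ J, ∀ M' ∈ J, pdm (w M) z = pdm (w M') z → M = M' := by
  classical
  obtain ⟨ε, hε, hD, hcont⟩ := cont_branch G R hx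
  set B := Metric.ball x ε with hB
  have hBo : IsOpen B := Metric.isOpen_ball
  have hBp : IsPreconnected B := (convex_ball x ε).isPreconnected
  have hxB : x ∈ B := Metric.mem_ball_self hε
  have hloc := fun i k => roots_local (Q i k) D (R.sep i k) (R.lc i k) x hx
  choose r ρ hcard hev using hloc
  let T : Finset (Fin n → Fin n → ℂ) :=
    Fintype.piFinset fun i => Fintype.piFinset fun k => (r i k).image fun a => ρ i k a x
  have hT : ∀ w, Branch g h H w x → pdm w x ∈ T := by
    intro w hw
    refine Fintype.mem_piFinset.2 fun i => Fintype.mem_piFinset.2 fun k => Finset.mem_image.2 ?_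
    obtain ⟨a, ha, he⟩ := ((hev i k).self_of_nhds.2.1 _).1 ((branch_root G R hw).self_of_nhds i k)
    exact ⟨a, ha, he.symm⟩
  have hTc : T.card ≤ ∏ i, ∏ k, (Q i k).natDegree := by
    simp only [T, Fintype.card_piFinset]
    refine Finset.prod_le_prod' fun i _ => Finset.prod_le_prod' fun k _ => ?_
    rw [← hcard i k]
    exact Finset.card_image_le
  let J := T.filter fun M => ∃ w, Branch g h H w x ∧ pdm w x = M
  have hex : ∀ M, ∃ w : (Fin n → ℂ) → Fin n → ℂ, M ∈ J → (∀ z ∈ B, Branch g h H w z) ∧ pdm w x = M := by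
    intro M
    by_cases hM : M ∈ J
    · obtain ⟨-, w, hw, hwM⟩ := Finset.mem_filter.1 hM
      obtain ⟨w', hw', he⟩ := hcont x hxB w hw
      exact ⟨w', fun _ => ⟨hw', (pdm_congr he).trans hwM⟩⟩
    · exact ⟨0, fun h => absurd h hM⟩
  choose w hw using hex
  have hid : ∀ {v v' : (Fin n → ℂ) → Fin n → ℂ}, (∀ z ∈ B, Branch g h H v z) → (∀ z ∈ B, Branch g h H v' z) →
      ∀ z ∈ B, pdm v z = pdm v' z → Set.EqOn v v' B := by
    intro v v' hv hv' z hz he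
    have := np_unique G np R (hD z hz) (hv z hz) (hv' z hz) fun i k => congrFun (congrFun he i) k
    exact (show AnalyticOnNhd ℂ v B from fun z hz => (hv z hz).1).eqOn_of_preconnected_of_eventuallyEq
      (fun z hz => (hv' z hz).1) hBp hz this
  refine ⟨J, w, (Finset.card_le_card (Finset.filter_subset _ _)).trans hTc, ?_⟩
  filter_upwards [hBo.mem_nhds hxB] with z hz
  refine ⟨hD z hz, fun M hM => (hw M hM).1 z hz, ?_, ?_⟩
  · intro v hv
    obtain ⟨v', hv', he⟩ := hcont z hz v hv
    have hMJ : pdm v' x ∈ J := Finset.mem_filter.2 ⟨hT v' (hv' x hxB), v', hv' x hxB, rfl⟩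
    refine ⟨_, hMJ, he.symm.trans ?_⟩
    have := hid hv' (hw _ hMJ).1 x hxB (hw _ hMJ).2.symm
    filter_upwards [hBo.mem_nhds hz] with y hy using this hy
  · intro M hM M' hM' he
    have := hid (hw M hM).1 (hw M' hM').1 z hz he
    rw [← (hw M hM).2, ← (hw M' hM').2]
    exact pdm_congr (by filter_upwards [hBo.mem_nhds hxB] with y hy using this hy)

/-- the fibre of branches -/
def fib (g h : Fin n → (Fin n → ℂ) → ℂ) (H : (Fin n → ℂ) → ℂ) (x : Fin n → ℂ) :
    Set ((Fin n → ℂ) × (Fin n → Fin n → ℂ)) :=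
  {s | ∃ w, Branch g h H w x ∧ s = (w x, pdm w x)}

noncomputable def Pf (g h : Fin n → (Fin n → ℂ) → ℂ) (H : (Fin n → ℂ) → ℂ) (i : Fin n) (l : ℂ)
    (x : Fin n → ℂ) : ℂ := ∏ᶠ s ∈ fib g h H x, (l - s.1 i)

noncomputable def Sf (g h : Fin n → (Fin n → ℂ) → ℂ) (H : (Fin n → ℂ) → ℂ) (i : Fin n)
    (x : Fin n → ℂ) : ℝ := ∑ᶠ s ∈ fib g h H x, Real.sqrt (1 + ‖s.1 i‖ ^ 2)

lemma local_PS (G : Good φ g h H) (np : NoPer φ H) {Q : Fin n → Fin n → Polynomial (MvPolynomial (Fin n) ℂ)}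
    {D : MvPolynomial (Fin n) ℂ} (R : RelData φ H Q D) {x : Fin n → ℂ} (hx : eval x D ≠ 0) :
    ∃ (J : Finset (Fin n → Fin n → ℂ)) (w : (Fin n → Fin n → ℂ) → (Fin n → ℂ) → Fin n → ℂ),
      J.card ≤ ∏ i, ∏ k, (Q i k).natDegree ∧ ∀ᶠ z in 𝓝 x, (∀ M ∈ J, Branch g h H (w M) z) ∧
      (∀ v, Branch g h H v z → ∃ M ∈ J, v =ᶠ[𝓝 z] w M) ∧
      (∀ i l, Pf g h H i l z = ∏ M ∈ J, (l - w M z i)) ∧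
      (∀ i, Sf g h H i z = ∑ M ∈ J, Real.sqrt (1 + ‖w M z i‖ ^ 2)) := by
  classical
  obtain ⟨J, w, hJ, hev⟩ := local_struct G np R hx
  refine ⟨J, w, hJ, ?_⟩
  filter_upwards [hev] with z hz
  obtain ⟨-, h1, h2, h3⟩ := hz
  have hfib : fib g h H z = (J.image fun M => (w M z, pdm (w M) z) : Finset _) := by
    ext s
    simp only [fib, Set.mem_ofPred_eq, Finset.coe_image, Set.mem_image, Finset.mem_coe]
    constructor
    · rintro ⟨v, hv, rfl⟩
      obtain ⟨M, hM, he⟩ := h2 v hv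
      exact ⟨M, hM, by rw [he.self_of_nhds, pdm_congr he]⟩
    · rintro ⟨M, hM, rfl⟩
      exact ⟨w M, h1 M hM, rfl⟩
  have hinj : Set.InjOn (fun M => (w M z, pdm (w M) z)) (J : Set (Fin n → Fin n → ℂ)) :=
    fun M hM M' hM' he => h3 M hM M' hM' (congrArg Prod.snd he)
  refine ⟨h1, h2, fun i l => ?_, fun i => ?_⟩
  · rw [Pf, hfib, finprod_mem_coe_finset, Finset.prod_image hinj]
  · rw [Sf, hfib, finsum_mem_coe_finset, Finset.sum_image hinj]

end NP

open MvPolynomial Filter Topology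

section Growth

lemma seg_bound {p : Polynomial ℂ} {σ : ℂ → ℝ} {W : ℂ → ℝ}
    (hd : ∀ t, p.eval t ≠ 0 → ∀ c : ℂ, ∃ σ', HasDerivAt (fun s : ℝ => σ (t + s * c)) σ' 0 ∧
      |σ'| ≤ ‖c‖ * (W t / ‖p.eval t‖)) {a b : ℂ} {K : ℝ}
    (hs : ∀ s ∈ Set.Icc (0:ℝ) 1, p.eval (a + s * (b - a)) ≠ 0 ∧
      W (a + s * (b - a)) / ‖p.eval (a + s * (b - a))‖ ≤ K) :
    σ b ≤ σ a + K * ‖b - a‖ := by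
  have h1 : ∀ s ∈ Set.Icc (0:ℝ) 1, ∃ σ', HasDerivAt (fun s : ℝ => σ (a + s * (b - a))) σ' s ∧ |σ'| ≤ K * ‖b - a‖ := by
    intro s hs'
    obtain ⟨hp, hK⟩ := hs s hs'
    obtain ⟨σ', h2, h3⟩ := hd _ hp (b - a)
    refine ⟨σ', ?_, h3.trans ?_⟩
    · have h4 : HasDerivAt (fun s' : ℝ => s' - s) 1 s := (hasDerivAt_id s).sub_const s
      have h5 : HasDerivAt (fun s_1 : ℝ => σ (a + s * (b - a) + s_1 * (b - a))) σ' ((fun s' : ℝ => s' - s) s) := by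
        simpa using h2
      have h6 := HasDerivAt.comp (h := fun s' : ℝ => s' - s) s h5 h4
      rw [mul_one] at h6
      refine h6.congr_of_eventuallyEq (Eventually.of_forall fun s' => ?_)
      simp only [Function.comp]
      congr 1; push_cast; ring
    · rw [mul_comm]; gcongr
  choose! f' hf' hb using h1
  have := (convex_Icc (0:ℝ) 1).norm_image_sub_le_of_norm_hasDerivWithin_le
    (fun s hs => (hf' s hs).hasDerivWithinAt) (fun s hs => hb s hs) (Set.left_mem_Icc.2 zero_le_one)
    (Set.right_mem_Icc.2 zero_le_one)
  simp only [Complex.ofReal_zero, Complex.ofReal_one, zero_mul, one_mul, add_zero, add_sub_cancel,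
    sub_zero, norm_one, mul_one, Real.norm_eq_abs] at this
  linarith [le_abs_self (σ b - σ a)]

lemma poly_lower (p : Polynomial ℂ) (hp : p ≠ 0) : ∃ R c : ℝ, 1 ≤ R ∧ 0 < c ∧ ∀ t, R ≤ ‖t‖ → c ≤ ‖p.eval t‖ := by
  by_cases hdeg : 0 < p.degree
  · have h := p.tendsto_norm_atTop hdeg (tendsto_norm_cobounded_atTop (E := ℂ))
    obtain ⟨R, -, hR⟩ := Filter.hasBasis_cobounded_norm.eventually_iff.1 (h.eventually_ge_atTop 1)
    exact ⟨max 1 R, 1, le_max_left _ _, one_pos, fun t ht => hR ((le_max_right _ _).trans ht)⟩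
  · have h := Polynomial.eq_C_of_degree_le_zero (not_lt.1 hdeg)
    refine ⟨1, ‖p.coeff 0‖, le_rfl, ?_, fun t _ => ?_⟩
    · rw [norm_pos_iff]; intro h0; rw [h0, Polynomial.C_0] at h; exact hp h
    · rw [h]; simp

lemma growth_inf {p : Polynomial ℂ} (hp0 : p ≠ 0) {σ : ℂ → ℝ} {C : ℝ} (hC : 0 ≤ C) {M : ℕ}
    (hd : ∀ t, p.eval t ≠ 0 → ∀ c : ℂ, ∃ σ', HasDerivAt (fun s : ℝ => σ (t + s * c)) σ' 0 ∧
      |σ'| ≤ ‖c‖ * (C * (1 + ‖t‖) ^ M / ‖p.eval t‖)) (hc : ∀ t, p.eval t ≠ 0 → ContinuousAt σ t) :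
    ∃ C', ∀ᶠ t in Bornology.cobounded ℂ, σ t ≤ C' * ‖t‖ ^ (M + 1) := by
  obtain ⟨R, c, hR, hc0, hl⟩ := poly_lower p hp0
  have hR0 : 0 < R := by linarith
  have hne : ∀ t, R ≤ ‖t‖ → p.eval t ≠ 0 := fun t ht h0 => by
    have := hl t ht; rw [h0, norm_zero] at this; linarith
  obtain ⟨m, hm⟩ := (isCompact_sphere (0:ℂ) R).exists_bound_of_continuousOn (f := σ)
    (fun t ht => (hc t (hne t (by simpa using (mem_sphere_zero_iff_norm.1 ht).ge))).continuousWithinAt)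
  refine ⟨|m| + C * 2 ^ M / c, Filter.hasBasis_cobounded_norm.eventually_iff.2 ⟨R, trivial, fun t (ht : R ≤ ‖t‖) => ?_⟩⟩
  have ht0 : 0 < ‖t‖ := hR0.trans_le ht
  have ht1 : 1 ≤ ‖t‖ := hR.trans ht
  have hta : t ≠ 0 := norm_pos_iff.1 ht0
  set a : ℂ := ((R / ‖t‖ : ℝ) : ℂ) * t with ha
  have hq : R / ‖t‖ ≤ 1 := (div_le_one ht0).2 ht
  have hna : ‖a‖ = R := by
    rw [ha, norm_mul, Complex.norm_real, Real.norm_eq_abs, abs_of_pos (by positivity)]; field_simp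
  have hab : t - a = ((1 - R / ‖t‖ : ℝ) : ℂ) * t := by rw [ha]; push_cast; ring
  have h1 : ‖t - a‖ ≤ ‖t‖ := by
    rw [hab, norm_mul, Complex.norm_real, Real.norm_eq_abs, abs_of_nonneg (by linarith)]
    refine mul_le_of_le_one_left ht0.le ?_
    linarith [show (0:ℝ) ≤ R / ‖t‖ by positivity]
  have key := seg_bound hd (a := a) (b := t) (K := C * (2 * ‖t‖) ^ M / c) (by
    intro s hs
    have e : a + s * (t - a) = ((R / ‖t‖ + s * (1 - R / ‖t‖) : ℝ) : ℂ) * t := by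
      rw [hab, ha]; push_cast; ring
    have hq0 : 0 < R / ‖t‖ := by positivity
    have hτ1 : R / ‖t‖ ≤ R / ‖t‖ + s * (1 - R / ‖t‖) := by nlinarith [hs.1]
    have hτ2 : R / ‖t‖ + s * (1 - R / ‖t‖) ≤ 1 := by nlinarith [hs.2]
    have hn : ‖a + s * (t - a)‖ = (R / ‖t‖ + s * (1 - R / ‖t‖)) * ‖t‖ := by
      rw [e, norm_mul, Complex.norm_real, Real.norm_eq_abs, abs_of_pos (by linarith)]
    have hn1 : R ≤ ‖a + s * (t - a)‖ := by
      rw [hn]; calc R = R / ‖t‖ * ‖t‖ := by field_simp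
        _ ≤ _ := by gcongr
    have hn2 : ‖a + s * (t - a)‖ ≤ ‖t‖ := by
      rw [hn]; exact mul_le_of_le_one_left ht0.le hτ2
    refine ⟨hne _ hn1, ?_⟩
    have := hl _ hn1
    gcongr
    linarith)
  have h2 : σ a ≤ |m| := (le_abs_self _).trans ((hm a (by simpa using hna)).trans (le_abs_self m))
  calc σ t ≤ σ a + C * (2 * ‖t‖) ^ M / c * ‖t - a‖ := key
    _ ≤ |m| + C * (2 * ‖t‖) ^ M / c * ‖t‖ := by gcongr
    _ = |m| * 1 + C * 2 ^ M / c * ‖t‖ ^ (M + 1) := by rw [mul_pow]; ring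
    _ ≤ |m| * ‖t‖ ^ (M + 1) + C * 2 ^ M / c * ‖t‖ ^ (M + 1) := by
        gcongr; exact one_le_pow₀ ht1
    _ = _ := by ring

lemma growth_loc {p : Polynomial ℂ} (hp0 : p ≠ 0) {σ : ℂ → ℝ} {C : ℝ} (hC : 0 ≤ C) {M : ℕ}
    (hd : ∀ t, p.eval t ≠ 0 → ∀ c : ℂ, ∃ σ', HasDerivAt (fun s : ℝ => σ (t + s * c)) σ' 0 ∧
      |σ'| ≤ ‖c‖ * (C * (1 + ‖t‖) ^ M / ‖p.eval t‖)) (hc : ∀ t, p.eval t ≠ 0 → ContinuousAt σ t) (t0 : ℂ) :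
    ∃ B, ∀ᶠ s in 𝓝[≠] t0, ‖p.eval s‖ * σ s ≤ B := by
  obtain ⟨q, hpq, hqd⟩ := Polynomial.exists_eq_pow_rootMultiplicity_mul_and_not_dvd p hp0 t0
  set m := p.rootMultiplicity t0 with hm
  have hq0 : q.eval t0 ≠ 0 := fun h => hqd (Polynomial.dvd_iff_isRoot.2 h)
  have hpe : ∀ s, ‖p.eval s‖ = ‖s - t0‖ ^ m * ‖q.eval s‖ := by
    intro s
    conv_lhs => rw [hpq]
    simp
  have hqc : ContinuousAt (fun s => ‖q.eval s‖) t0 := q.continuous.norm.continuousAt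
  have hn0 : 0 < ‖q.eval t0‖ := norm_pos_iff.2 hq0
  have hev : ∀ᶠ s in 𝓝 t0, ‖q.eval t0‖ / 2 < ‖q.eval s‖ ∧ ‖q.eval s‖ < 2 * ‖q.eval t0‖ :=
    (hqc.tendsto.eventually_const_lt (by linarith)).and (hqc.tendsto.eventually_lt_const (by linarith))
  obtain ⟨r', hr', hb⟩ := Metric.eventually_nhds_iff_ball.1 hev
  set r := min 1 (r' / 2) with hr
  have hr0 : 0 < r := by positivity
  have hr1 : r ≤ 1 := min_le_left _ _
  have hb' : ∀ s, ‖s - t0‖ ≤ r → ‖q.eval t0‖ / 2 ≤ ‖q.eval s‖ ∧ ‖q.eval s‖ ≤ 2 * ‖q.eval t0‖ := by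
    intro s hs
    have := hb s (by
      rw [Metric.mem_ball, dist_eq_norm]
      have : r ≤ r' / 2 := min_le_right _ _
      linarith)
    exact ⟨this.1.le, this.2.le⟩
  set c0 := ‖q.eval t0‖ / 2 with hc0
  have hc0p : 0 < c0 := by positivity
  have hne : ∀ s, ‖s - t0‖ ≤ r → s ≠ t0 → p.eval s ≠ 0 := by
    intro s hs hst
    rw [← norm_pos_iff, hpe]
    have := (hb' s hs).1
    have h2 : 0 < ‖s - t0‖ := norm_pos_iff.2 (sub_ne_zero.2 hst)
    have : 0 < ‖q.eval s‖ := by linarith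
    positivity
  obtain ⟨mm, hmm⟩ := (isCompact_sphere t0 r).exists_bound_of_continuousOn (f := σ)
    (fun t ht => (hc t (hne t (by rw [← dist_eq_norm]; exact (Metric.mem_sphere.1 ht).le) (by
      rintro rfl; rw [Metric.mem_sphere, dist_self] at ht; linarith))).continuousWithinAt)
  refine ⟨2 * ‖q.eval t0‖ * |mm| + 2 * ‖q.eval t0‖ * (C * (2 + ‖t0‖) ^ M / c0), ?_⟩
  have hball : ∀ᶠ s in 𝓝[≠] t0, ‖s - t0‖ < r := by
    refine nhdsWithin_le_nhds ?_
    filter_upwards [Metric.ball_mem_nhds t0 hr0] with s hs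
    rwa [Metric.mem_ball, dist_eq_norm] at hs
  filter_upwards [hball, self_mem_nhdsWithin] with s hs hst
  have hst' : s ≠ t0 := hst
  set δ := ‖s - t0‖ with hδ
  have hδ0 : 0 < δ := norm_pos_iff.2 (sub_ne_zero.2 hst')
  set a : ℂ := t0 + ((r / δ : ℝ) : ℂ) * (s - t0) with ha
  have hq1 : 1 ≤ r / δ := (one_le_div hδ0).2 hs.le
  have hna : ‖a - t0‖ = r := by
    rw [ha, add_sub_cancel_left, norm_mul, Complex.norm_real, Real.norm_eq_abs, abs_of_pos (by positivity), ← hδ]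
    field_simp
  have hsa : s - a = ((1 - r / δ : ℝ) : ℂ) * (s - t0) := by rw [ha]; push_cast; ring
  have h1 : ‖s - a‖ ≤ 1 := by
    rw [hsa, norm_mul, Complex.norm_real, Real.norm_eq_abs, abs_of_nonpos (by linarith), ← hδ]
    have : r / δ * δ = r := by field_simp
    nlinarith
  have key := seg_bound hd (a := a) (b := s) (K := C * (2 + ‖t0‖) ^ M / (δ ^ m * c0)) (by
    intro τ hτ
    have e : a + τ * (s - a) - t0 = ((r / δ + τ * (1 - r / δ) : ℝ) : ℂ) * (s - t0) := by
      rw [hsa, ha]; push_cast; ring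
    have hτ1 : r / δ + τ * (1 - r / δ) ≤ r / δ := by nlinarith [hτ.1]
    have hτ2 : 1 ≤ r / δ + τ * (1 - r / δ) := by nlinarith [hτ.2]
    have hn : ‖a + τ * (s - a) - t0‖ = (r / δ + τ * (1 - r / δ)) * δ := by
      rw [e, norm_mul, Complex.norm_real, Real.norm_eq_abs, abs_of_pos (by linarith)]
    have hn1 : ‖a + τ * (s - a) - t0‖ ≤ r := by
      rw [hn]; calc _ ≤ r / δ * δ := by gcongr
        _ = r := by field_simp
    have hn2 : δ ≤ ‖a + τ * (s - a) - t0‖ := by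
      rw [hn]; exact le_mul_of_one_le_left hδ0.le hτ2
    refine ⟨hne _ hn1 ?_, ?_⟩
    · intro h; rw [h, sub_self, norm_zero] at hn2; linarith
    · have hz : ‖a + τ * (s - a)‖ ≤ ‖t0‖ + r := by
        calc ‖a + τ * (s - a)‖ = ‖t0 + (a + τ * (s - a) - t0)‖ := by congr 1; ring
          _ ≤ _ := (norm_add_le _ _).trans (by gcongr)
      rw [hpe]
      have := (hb' _ hn1).1
      have hz' : (1 + ‖a + τ * (s - a)‖) ^ M ≤ (2 + ‖t0‖) ^ M :=
        pow_le_pow_left₀ (by positivity) (by linarith) M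
      have hz2 : δ ^ m ≤ ‖a + τ * (s - a) - t0‖ ^ m := pow_le_pow_left₀ hδ0.le hn2 m
      exact div_le_div₀ (by positivity) (mul_le_mul_of_nonneg_left hz' hC) (by positivity)
        (mul_le_mul hz2 this hc0p.le (by positivity)))
  have h2 : σ a ≤ |mm| := (le_abs_self _).trans
    ((hmm a (by rw [Metric.mem_sphere, dist_eq_norm]; exact hna)).trans (le_abs_self mm))
  have h3 : ‖p.eval s‖ ≤ δ ^ m * (2 * ‖q.eval t0‖) := by
    rw [hpe]; gcongr; exact (hb' s hs.le).2
  have hδm : δ ^ m ≤ 1 := pow_le_one₀ hδ0.le (hs.le.trans hr1)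
  calc ‖p.eval s‖ * σ s ≤ ‖p.eval s‖ * (|mm| + C * (2 + ‖t0‖) ^ M / (δ ^ m * c0)) := by
        gcongr
        refine key.trans ?_
        have : C * (2 + ‖t0‖) ^ M / (δ ^ m * c0) * ‖s - a‖ ≤ C * (2 + ‖t0‖) ^ M / (δ ^ m * c0) * 1 := by gcongr
        linarith
    _ ≤ δ ^ m * (2 * ‖q.eval t0‖) * (|mm| + C * (2 + ‖t0‖) ^ M / (δ ^ m * c0)) := by gcongr
    _ = δ ^ m * (2 * ‖q.eval t0‖ * |mm|) + 2 * ‖q.eval t0‖ * (C * (2 + ‖t0‖) ^ M / c0) := by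
        field_simp
    _ ≤ 1 * (2 * ‖q.eval t0‖ * |mm|) + 2 * ‖q.eval t0‖ * (C * (2 + ‖t0‖) ^ M / c0) := by gcongr
    _ = _ := by ring

end Growth

open MvPolynomial Filter Topology

section RootBound

variable {n : ℕ}

/-- polynomially bounded -/
def PB (f : (Fin n → ℂ) → ℝ) : Prop := ∃ (C : ℝ) (M : ℕ), 0 ≤ C ∧ ∀ x, f x ≤ C * (1 + ‖x‖) ^ M

lemma PB.add {f f' : (Fin n → ℂ) → ℝ} (hf : PB f) (hf' : PB f') : PB fun x => f x + f' x := by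
  obtain ⟨C, M, hC, h⟩ := hf
  obtain ⟨C', M', hC', h'⟩ := hf'
  refine ⟨C + C', M + M', by positivity, fun x => ?_⟩
  have h1 : (1:ℝ) ≤ 1 + ‖x‖ := by linarith [norm_nonneg x]
  have h2 : (1 + ‖x‖) ^ M ≤ (1 + ‖x‖) ^ (M + M') := pow_le_pow_right₀ h1 (by omega)
  have h3 : (1 + ‖x‖) ^ M' ≤ (1 + ‖x‖) ^ (M + M') := pow_le_pow_right₀ h1 (by omega)
  calc _ ≤ C * (1 + ‖x‖) ^ M + C' * (1 + ‖x‖) ^ M' := add_le_add (h x) (h' x)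
    _ ≤ C * (1 + ‖x‖) ^ (M + M') + C' * (1 + ‖x‖) ^ (M + M') := by gcongr
    _ = _ := by ring

lemma PB.mul {f f' : (Fin n → ℂ) → ℝ} (hf : PB f) (hf' : PB f') (h0 : ∀ x, 0 ≤ f x) (h0' : ∀ x, 0 ≤ f' x) :
    PB fun x => f x * f' x := by
  obtain ⟨C, M, hC, h⟩ := hf
  obtain ⟨C', M', hC', h'⟩ := hf'
  refine ⟨C * C', M + M', by positivity, fun x => ?_⟩
  calc _ ≤ (C * (1 + ‖x‖) ^ M) * (C' * (1 + ‖x‖) ^ M') := mul_le_mul (h x) (h' x) (h0' x) (by positivity)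
    _ = _ := by ring

lemma PB.const (c : ℝ) : PB (fun _ : Fin n → ℂ => c) :=
  ⟨|c|, 0, abs_nonneg c, fun x => by simpa using le_abs_self c⟩

lemma PB.sum {ι : Type*} (s : Finset ι) (f : ι → (Fin n → ℂ) → ℝ) (hf : ∀ i ∈ s, PB (f i)) :
    PB fun x => ∑ i ∈ s, f i x := by
  classical
  induction s using Finset.induction_on with
  | empty => simpa using PB.const 0
  | insert a s ha ih =>
    simp only [Finset.sum_insert ha]
    exact (hf a (Finset.mem_insert_self _ _)).add (ih fun i hi => hf i (Finset.mem_insert_of_mem hi))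

lemma PB.mono {f f' : (Fin n → ℂ) → ℝ} (hf : PB f) (h : ∀ x, f' x ≤ f x) : PB f' := by
  obtain ⟨C, M, hC, h'⟩ := hf
  exact ⟨C, M, hC, fun x => (h x).trans (h' x)⟩

lemma PB.poly (P : MvPolynomial (Fin n) ℂ) : PB fun x => ‖eval x P‖ := by
  induction P using MvPolynomial.induction_on with
  | C a => simpa using PB.const ‖a‖
  | add p q hp hq => exact (hp.add hq).mono fun x => by rw [map_add]; exact norm_add_le _ _
  | mul_X p i hp =>
    refine (hp.mul (f' := fun x => ‖x‖) ⟨1, 1, zero_le_one, fun x => by simp⟩ (fun x => norm_nonneg _)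
      (fun x => norm_nonneg _)).mono fun x => ?_
    rw [map_mul, eval_X, norm_mul]
    gcongr
    exact norm_le_pi_norm x i

lemma root_bound1 (q : Polynomial ℂ) (hq : q ≠ 0) {y : ℂ} (hy : q.eval y = 0) :
    ‖q.leadingCoeff‖ * ‖y‖ ≤ ∑ j ∈ Finset.range (q.natDegree + 1), ‖q.coeff j‖ := by
  have hl : 0 < ‖q.leadingCoeff‖ := norm_pos_iff.2 (Polynomial.leadingCoeff_ne_zero.2 hq)
  have hroot := Polynomial.IsRoot.norm_lt_cauchyBound hq hy
  rw [Polynomial.cauchyBound] at hroot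
  have h2 : (((Finset.range q.natDegree).sup fun x => ‖q.coeff x‖₊ : NNReal) : ℝ) ≤ ∑ j ∈ Finset.range q.natDegree, ‖q.coeff j‖ := by
    have : (Finset.range q.natDegree).sup (fun x => ‖q.coeff x‖₊) ≤ ∑ j ∈ Finset.range q.natDegree, ‖q.coeff j‖₊ :=
      Finset.sup_le fun j hj => Finset.single_le_sum (f := fun j => ‖q.coeff j‖₊) (fun _ _ => zero_le) hj
    have := NNReal.coe_le_coe.2 this
    push_cast at this
    exact this
  have h3 : ‖y‖ < (((Finset.range q.natDegree).sup fun x => ‖q.coeff x‖₊ : NNReal) : ℝ) / ‖q.leadingCoeff‖ + 1 := by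
    have := NNReal.coe_lt_coe.2 hroot
    push_cast at this
    simpa using this
  rw [Finset.sum_range_succ]
  calc _ ≤ ‖q.leadingCoeff‖ * ((((Finset.range q.natDegree).sup fun x => ‖q.coeff x‖₊ : NNReal) : ℝ) / ‖q.leadingCoeff‖ + 1) := by gcongr
    _ = (((Finset.range q.natDegree).sup fun x => ‖q.coeff x‖₊ : NNReal) : ℝ) + ‖q.leadingCoeff‖ := by field_simp
    _ ≤ _ := by gcongr; rfl

lemma root_bound (Q : Polynomial (MvPolynomial (Fin n) ℂ)) (D : MvPolynomial (Fin n) ℂ) (hl : Q.leadingCoeff ∣ D) :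
    ∃ f : (Fin n → ℂ) → ℝ, PB f ∧ (∀ x, 0 ≤ f x) ∧ ∀ x, eval x D ≠ 0 → ∀ y, Qe Q x y = 0 → ‖eval x D‖ * ‖y‖ ≤ f x := by
  obtain ⟨c, hc⟩ := hl
  refine ⟨fun x => ‖eval x c‖ * ∑ j ∈ Finset.range (Q.natDegree + 1), ‖eval x (Q.coeff j)‖,
    (PB.poly c).mul (PB.sum _ _ fun j _ => PB.poly _) (fun _ => norm_nonneg _)
      (fun _ => Finset.sum_nonneg fun _ _ => norm_nonneg _), fun x => by positivity, ?_⟩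
  intro x hx y hy
  rw [hc, map_mul] at hx ⊢
  obtain ⟨h1, h2⟩ := mul_ne_zero_iff.1 hx
  have hdeg := Polynomial.natDegree_map_of_leadingCoeff_ne_zero (eval x) h1
  have hlc := Polynomial.leadingCoeff_map_of_leadingCoeff_ne_zero (eval x) h1
  have := root_bound1 (Q.map (eval x)) (by rw [← Polynomial.leadingCoeff_ne_zero, hlc]; exact h1) hy
  rw [hlc, hdeg] at this
  simp only [Polynomial.coeff_map] at this
  calc _ = ‖eval x c‖ * (‖eval x Q.leadingCoeff‖ * ‖y‖) := by rw [norm_mul]; ring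
    _ ≤ _ := mul_le_mul_of_nonneg_left this (norm_nonneg _)

lemma root_bound_all {m : ℕ} (Q : Fin m → Fin m → Polynomial (MvPolynomial (Fin n) ℂ)) (D : MvPolynomial (Fin n) ℂ)
    (hl : ∀ i k, (Q i k).leadingCoeff ∣ D) :
    ∃ (C : ℝ) (M : ℕ), 0 ≤ C ∧ ∀ x, eval x D ≠ 0 → ∀ i k y, Qe (Q i k) x y = 0 →
      ‖eval x D‖ * ‖y‖ ≤ C * (1 + ‖x‖) ^ M := by
  choose f hf h0 hb using fun i k => root_bound (Q i k) D (hl i k)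
  obtain ⟨C, M, hC, hCM⟩ := PB.sum Finset.univ (fun i x => ∑ k, f i k x) fun i _ => PB.sum Finset.univ (f i) fun k _ => hf i k
  refine ⟨C, M, hC, fun x hx i k y hy => (hb i k x hx y hy).trans (le_trans ?_ (hCM x))⟩
  calc f i k x ≤ ∑ k, f i k x := Finset.single_le_sum (f := fun k => f i k x) (fun k _ => h0 i k x) (Finset.mem_univ k)
    _ ≤ _ := Finset.single_le_sum (f := fun i => ∑ k, f i k x) (fun i _ => Finset.sum_nonneg fun k _ => h0 i k x) (Finset.mem_univ i)

end RootBound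

open MvPolynomial Filter Topology

section LineP

variable {n : ℕ} {φ g h : Fin n → (Fin n → ℂ) → ℂ} {H : (Fin n → ℂ) → ℂ}

/-- restriction of a polynomial to a coordinate line -/
noncomputable def lineP (P : MvPolynomial (Fin n) ℂ) (x : Fin n → ℂ) (k : Fin n) : Polynomial ℂ :=
  aeval (Function.update (fun j => Polynomial.C (x j)) k Polynomial.X) P

lemma lineP_eval (P : MvPolynomial (Fin n) ℂ) (x : Fin n → ℂ) (k : Fin n) (t : ℂ) :
    (lineP P x k).eval t = eval (Function.update x k t) P := by
  unfold lineP
  induction P using MvPolynomial.induction_on with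
  | C a => simp
  | add p q hp hq => simp [hp, hq]
  | mul_X p i hp =>
    simp only [map_mul, Polynomial.eval_mul, hp, aeval_X, eval_X]
    by_cases hi : i = k
    · subst hi; simp
    · simp [hi]

lemma norm_upd (x : Fin n → ℂ) (k : Fin n) (t : ℂ) : 1 + ‖Function.update x k t‖ ≤ (1 + ‖x‖) * (1 + ‖t‖) := by
  have : ‖Function.update x k t‖ ≤ ‖x‖ + ‖t‖ := by
    refine (pi_norm_le_iff_of_nonneg (by positivity)).2 fun j => ?_
    by_cases hj : j = k
    · subst hj; simp
    · simp only [Function.update_of_ne hj]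
      linarith [norm_le_pi_norm x j, norm_nonneg t]
  nlinarith [mul_nonneg (norm_nonneg x) (norm_nonneg t)]

lemma upd_deriv (x : Fin n → ℂ) (k : Fin n) (t : ℂ) : HasDerivAt (fun t => Function.update x k t) (Pi.single k 1) t := by
  exact hasDerivAt_update x k t

lemma comp_upd_deriv {f : (Fin n → ℂ) → ℂ} {x : Fin n → ℂ} {k : Fin n} {t : ℂ}
    (hf : DifferentiableAt ℂ f (Function.update x k t)) :
    HasDerivAt (fun t => f (Function.update x k t)) (pd f k (Function.update x k t)) t :=
  hf.hasFDerivAt.comp_hasDerivAt t (upd_deriv x k t)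

lemma sqrt_deriv {γ : ℝ → ℂ} {γ' : ℂ} (hγ : HasDerivAt γ γ' 0) :
    ∃ σ', HasDerivAt (fun s => Real.sqrt (1 + ‖γ s‖ ^ 2)) σ' 0 ∧ |σ'| ≤ ‖γ'‖ := by
  have h1 := ((hγ.norm_sq).const_add 1).sqrt (by positivity)
  refine ⟨_, h1, ?_⟩
  have hp : 0 < Real.sqrt (1 + ‖γ 0‖ ^ 2) := Real.sqrt_pos.2 (by positivity)
  have h2 : ‖γ 0‖ ≤ Real.sqrt (1 + ‖γ 0‖ ^ 2) := Real.le_sqrt_of_sq_le (by linarith)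
  rw [abs_div, abs_of_pos (by positivity : 0 < 2 * Real.sqrt (1 + ‖γ 0‖ ^ 2)), div_le_iff₀ (by positivity), abs_mul,
    abs_two]
  have h3 := abs_real_inner_le_norm (γ 0) γ'
  have h4 : ‖γ 0‖ * ‖γ'‖ ≤ Real.sqrt (1 + ‖γ 0‖ ^ 2) * ‖γ'‖ := by gcongr
  nlinarith

variable {Q : Fin n → Fin n → Polynomial (MvPolynomial (Fin n) ℂ)} {D : MvPolynomial (Fin n) ℂ}

lemma Sf_line_deriv (G : Good φ g h H) (np : NoPer φ H) (R : RelData φ H Q D) {C : ℝ} {M : ℕ} (hC : 0 ≤ C)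
    (hCM : ∀ x, eval x D ≠ 0 → ∀ i k y, Qe (Q i k) x y = 0 → ‖eval x D‖ * ‖y‖ ≤ C * (1 + ‖x‖) ^ M)
    (x0 : Fin n → ℂ) (k i : Fin n) (t : ℂ) (ht : eval (Function.update x0 k t) D ≠ 0) :
    (∀ c : ℂ, ∃ σ', HasDerivAt (fun s : ℝ => Sf g h H i (Function.update x0 k (t + s * c))) σ' 0 ∧
      |σ'| ≤ ‖c‖ * (((∏ i, ∏ k, (Q i k).natDegree : ℕ) * C * (1 + ‖x0‖) ^ M) * (1 + ‖t‖) ^ M / ‖(lineP D x0 k).eval t‖)) ∧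
    ContinuousAt (fun t => Sf g h H i (Function.update x0 k t)) t ∧
    ∀ l, DifferentiableAt ℂ (fun t => Pf g h H i l (Function.update x0 k t)) t := by
  set x := Function.update x0 k t with hx
  obtain ⟨J, w, hJ, hev⟩ := local_PS G np R ht
  have hcu : ContinuousAt (fun t => Function.update x0 k t) t := (upd_deriv x0 k t).continuousAt
  have hB := hev.self_of_nhds.1
  have hwi : ∀ N ∈ J, AnalyticAt ℂ (fun y => w N y i) x := fun N hN => analyticAt_pi_iff.1 (hB N hN).1 i
  refine ⟨fun c => ?_, ?_, fun l => ?_⟩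
  · have hcl : HasDerivAt (fun s : ℝ => t + s * c) c 0 := by
      have := ((Complex.ofRealCLM.hasDerivAt (x := (0:ℝ))).mul_const c).const_add t
      simpa using this
    have hγ : ∀ N ∈ J, HasDerivAt (fun s : ℝ => w N (Function.update x0 k (t + s * c)) i)
        (pd (fun y => w N y i) k x * c) 0 := by
      intro N hN
      have h1 := comp_upd_deriv (f := fun y => w N y i) (x := x0) (k := k) (t := t) (hwi N hN).differentiableAt
      have h2 : HasDerivAt (fun t => w N (Function.update x0 k t) i) (pd (fun y => w N y i) k x)
          ((fun s : ℝ => t + s * c) 0) := by simpa using h1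
      exact HasDerivAt.comp (h := fun s : ℝ => t + s * c) (0:ℝ) h2 hcl
    have hσ : ∀ N, ∃ σ', N ∈ J → HasDerivAt (fun s : ℝ => Real.sqrt (1 + ‖w N (Function.update x0 k (t + s * c)) i‖ ^ 2)) σ' 0 ∧
        |σ'| ≤ ‖pd (fun y => w N y i) k x * c‖ := by
      intro N
      by_cases hN : N ∈ J
      · obtain ⟨a, ha⟩ := sqrt_deriv (hγ N hN)
        exact ⟨a, fun _ => ha⟩
      · exact ⟨0, fun h => absurd h hN⟩
    choose σ' hσ using hσ
    refine ⟨∑ N ∈ J, σ' N, ?_, ?_⟩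
    · have h1 := HasDerivAt.fun_sum (u := J) (fun N hN => (hσ N hN).1)
      refine h1.congr_of_eventuallyEq ?_
      have h2 : Tendsto (fun s : ℝ => Function.update x0 k (t + s * c)) (𝓝 0) (𝓝 x) := by
        have : Tendsto (fun s : ℝ => t + s * c) (𝓝 0) (𝓝 t) := by
          simpa using hcl.continuousAt.tendsto
        exact hcu.tendsto.comp this
      filter_upwards [h2.eventually hev] with s hs
      exact hs.2.2.2 i
    · rw [lineP_eval, ← hx]
      have hDp : 0 < ‖eval x D‖ := norm_pos_iff.2 ht
      have hb : ∀ N ∈ J, |σ' N| ≤ ‖c‖ * (C * ((1 + ‖x0‖) ^ M * (1 + ‖t‖) ^ M) / ‖eval x D‖) := by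
        intro N hN
        refine (hσ N hN).2.trans ?_
        rw [norm_mul, mul_comm]
        gcongr
        rw [le_div_iff₀ hDp, mul_comm]
        refine (hCM x ht i k _ ((branch_root G R (hB N hN)).self_of_nhds i k)).trans ?_
        rw [← mul_pow]
        gcongr
        exact norm_upd x0 k t
      calc |∑ N ∈ J, σ' N| ≤ ∑ N ∈ J, |σ' N| := Finset.abs_sum_le_sum_abs _ _
        _ ≤ ∑ N ∈ J, ‖c‖ * (C * ((1 + ‖x0‖) ^ M * (1 + ‖t‖) ^ M) / ‖eval x D‖) := Finset.sum_le_sum hb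
        _ = J.card * (‖c‖ * (C * ((1 + ‖x0‖) ^ M * (1 + ‖t‖) ^ M) / ‖eval x D‖)) := by
            rw [Finset.sum_const, nsmul_eq_mul]
        _ ≤ (∏ i, ∏ k, (Q i k).natDegree : ℕ) * (‖c‖ * (C * ((1 + ‖x0‖) ^ M * (1 + ‖t‖) ^ M) / ‖eval x D‖)) := by
            have : (J.card : ℝ) ≤ (∏ i, ∏ k, (Q i k).natDegree : ℕ) := by exact_mod_cast hJ
            exact mul_le_mul_of_nonneg_right this (by positivity)
        _ = _ := by ring
  · have h1 : ContinuousAt (Sf g h H i) x := by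
      have h2 : ContinuousAt (fun z => ∑ M ∈ J, Real.sqrt (1 + ‖w M z i‖ ^ 2)) x :=
        tendsto_finsetSum _ fun N hN => (((hwi N hN).continuousAt.norm.pow 2).const_add 1).sqrt
      refine h2.congr ?_
      filter_upwards [hev] with z hz using (hz.2.2.2 i).symm
    exact ContinuousAt.comp (f := fun t => Function.update x0 k t) h1 hcu
  · have h1 : DifferentiableAt ℂ (Pf g h H i l) x := by
      have h2 : DifferentiableAt ℂ (fun z => ∏ M ∈ J, (l - w M z i)) x :=
        (Finset.analyticAt_fun_prod J fun N hN => (analyticAt_const (v := l)).sub (hwi N hN)).differentiableAt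
      refine h2.congr_of_eventuallyEq ?_
      filter_upwards [hev] with z hz using hz.2.2.1 i l
    exact (comp_upd_deriv h1).differentiableAt

lemma Pf_bound (G : Good φ g h H) (np : NoPer φ H) (R : RelData φ H Q D) (x : Fin n → ℂ) (hx : eval x D ≠ 0)
    (i : Fin n) (l : ℂ) :
    ‖(eval x D) ^ (∏ i, ∏ k, (Q i k).natDegree) * Pf g h H i l x‖ ≤
      (‖eval x D‖ * (1 + ‖l‖) + ‖eval x D‖ * Sf g h H i x) ^ (∏ i, ∏ k, (Q i k).natDegree) ∧ 0 ≤ Sf g h H i x := by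
  obtain ⟨J, w, hJ, hev⟩ := local_PS G np R hx
  obtain ⟨-, -, hP, hS⟩ := hev.self_of_nhds
  have hS0 : 0 ≤ Sf g h H i x := by rw [hS i]; positivity
  refine ⟨?_, hS0⟩
  have h1 : ∀ N ∈ J, ‖l - w N x i‖ ≤ 1 + ‖l‖ + Sf g h H i x := by
    intro N hN
    have h2 : ‖w N x i‖ ≤ Real.sqrt (1 + ‖w N x i‖ ^ 2) := Real.le_sqrt_of_sq_le (by linarith)
    have h3 : Real.sqrt (1 + ‖w N x i‖ ^ 2) ≤ Sf g h H i x := by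
      rw [hS i]
      exact Finset.single_le_sum (f := fun N => Real.sqrt (1 + ‖w N x i‖ ^ 2)) (fun _ _ => Real.sqrt_nonneg _) hN
    linarith [norm_sub_le l (w N x i)]
  have h2 : ‖Pf g h H i l x‖ ≤ (1 + ‖l‖ + Sf g h H i x) ^ (∏ i, ∏ k, (Q i k).natDegree) := by
    rw [hP i l, norm_prod]
    calc _ ≤ ∏ N ∈ J, (1 + ‖l‖ + Sf g h H i x) := Finset.prod_le_prod (fun _ _ => norm_nonneg _) h1
      _ = (1 + ‖l‖ + Sf g h H i x) ^ J.card := Finset.prod_const _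
      _ ≤ _ := pow_le_pow_right₀ (by linarith [norm_nonneg l]) hJ
  rw [norm_mul, norm_pow, ← mul_add, mul_pow]
  gcongr

end LineP

open MvPolynomial Filter Topology

section LineP2

variable {n : ℕ} {φ g h : Fin n → (Fin n → ℂ) → ℂ} {H : (Fin n → ℂ) → ℂ}
variable {Q : Fin n → Fin n → Polynomial (MvPolynomial (Fin n) ℂ)} {D : MvPolynomial (Fin n) ℂ}

lemma line_poly (G : Good φ g h H) (np : NoPer φ H) (R : RelData φ H Q D) :
    ∃ L : ℕ, ∀ (x0 : Fin n → ℂ) (k i : Fin n) (l : ℂ), eval x0 D ≠ 0 →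
      ∃ p : Polynomial ℂ, p.natDegree ≤ L ∧ ∀ t, eval (Function.update x0 k t) D ≠ 0 →
        (eval (Function.update x0 k t) D) ^ (∏ i, ∏ k, (Q i k).natDegree) * Pf g h H i l (Function.update x0 k t) = p.eval t := by
  obtain ⟨C, M, hC, hCM⟩ := root_bound_all Q D R.lc
  obtain ⟨C1, M1, hC1, hCM1⟩ := PB.poly D
  set N := ∏ i, ∏ k, (Q i k).natDegree with hN
  refine ⟨(M1 + (M + 1)) * N, fun x0 k i l hx0 => ?_⟩
  have hp0 : lineP D x0 k ≠ 0 := by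
    intro h0
    have := lineP_eval D x0 k (x0 k)
    rw [h0, Function.update_eq_self] at this
    exact hx0 (by simpa using this.symm)
  have hS := fun t (ht : (lineP D x0 k).eval t ≠ 0) => Sf_line_deriv G np R hC hCM x0 k i t (by rwa [← lineP_eval])
  have hCC : 0 ≤ (N : ℕ) * C * (1 + ‖x0‖) ^ M := by positivity
  obtain ⟨C', hinf⟩ := growth_inf hp0 (σ := fun t => Sf g h H i (Function.update x0 k t)) hCC
    (fun t ht => (hS t ht).1) (fun t ht => (hS t ht).2.1)
  have hloc := growth_loc hp0 (σ := fun t => Sf g h H i (Function.update x0 k t)) hCC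
    (fun t ht => (hS t ht).1) (fun t ht => (hS t ht).2.1)
  have hZ : ∀ t, ∀ᶠ s in 𝓝[≠] t, (lineP D x0 k).eval s ≠ 0 := by
    intro t
    have hfin := (lineP D x0 k).roots.toFinset.finite_toSet
    have : ((lineP D x0 k).roots.toFinset : Set ℂ) \ {t} ⊆ _ := Set.diff_subset
    have h2 := (hfin.subset this).isClosed.isOpen_compl.mem_nhds (x := t) (by simp)
    filter_upwards [mem_nhdsWithin_of_mem_nhds h2, self_mem_nhdsWithin] with s hs hst h0
    exact hs ⟨by simpa [hp0] using h0, hst⟩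
  obtain ⟨p, hp, hpe⟩ := poly1 {t | (lineP D x0 k).eval t = 0} (fun t => hZ t)
    (fun t => (eval (Function.update x0 k t) D) ^ N * Pf g h H i l (Function.update x0 k t))
    (by
      intro t ht
      have h1 : DifferentiableAt ℂ (fun t => eval (Function.update x0 k t) D) t := by
        simp only [← lineP_eval]; exact (lineP D x0 k).differentiableAt
      exact (h1.pow N).mul ((hS t ht).2.2 l))
    (by
      intro t
      obtain ⟨B, hB⟩ := hloc t
      have hc : ∀ᶠ s in 𝓝[≠] t, ‖(lineP D x0 k).eval s‖ ≤ ‖(lineP D x0 k).eval t‖ + 1 :=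
        mem_nhdsWithin_of_mem_nhds (((lineP D x0 k).continuous.norm.continuousAt.tendsto.eventually_lt_const
          (lt_add_one _)).mono fun _ h => h.le)
      refine ⟨((‖(lineP D x0 k).eval t‖ + 1) * (1 + ‖l‖) + B) ^ N, ?_⟩
      filter_upwards [hB, hc, hZ t] with s h1 h2 h3
      rw [lineP_eval] at h1 h2 h3
      obtain ⟨h4, h5⟩ := Pf_bound G np R _ h3 i l
      refine h4.trans (pow_le_pow_left₀ (by positivity) ?_ _)
      gcongr)
    ((M1 + (M + 1)) * N)
    (by
      refine ⟨(C1 * ((1 + ‖x0‖) * 2) ^ M1 * (1 + ‖l‖ + |C'|)) ^ N, ?_⟩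
      have hge : ∀ᶠ t in Bornology.cobounded ℂ, 1 ≤ ‖t‖ :=
        (tendsto_norm_cobounded_atTop (E := ℂ)).eventually_ge_atTop 1
      filter_upwards [hinf, hge] with t h1 h2 h3
      have h3' : eval (Function.update x0 k t) D ≠ 0 := by rw [← lineP_eval]; exact h3
      obtain ⟨h4, h5⟩ := Pf_bound G np R _ h3' i l
      rw [pow_mul, ← mul_pow]
      refine h4.trans (pow_le_pow_left₀ (by positivity) ?_ _)
      rw [← mul_add]
      have h6 : ‖eval (Function.update x0 k t) D‖ ≤ C1 * ((1 + ‖x0‖) * 2) ^ M1 * ‖t‖ ^ M1 := by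
        refine (hCM1 _).trans ?_
        rw [mul_assoc, ← mul_pow]
        gcongr
        refine (norm_upd x0 k t).trans ?_
        rw [mul_assoc]
        gcongr
        linarith
      have h7 : 1 + ‖l‖ + Sf g h H i (Function.update x0 k t) ≤ (1 + ‖l‖ + |C'|) * ‖t‖ ^ (M + 1) := by
        have h8 : 1 ≤ ‖t‖ ^ (M + 1) := one_le_pow₀ h2
        have h9 : C' * ‖t‖ ^ (M + 1) ≤ |C'| * ‖t‖ ^ (M + 1) := by gcongr; exact le_abs_self _
        have h10 : (1 + ‖l‖) * 1 ≤ (1 + ‖l‖) * ‖t‖ ^ (M + 1) := by gcongr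
        rw [add_mul]; linarith
      calc _ ≤ (C1 * ((1 + ‖x0‖) * 2) ^ M1 * ‖t‖ ^ M1) * ((1 + ‖l‖ + |C'|) * ‖t‖ ^ (M + 1)) := by gcongr
        _ = _ := by ring)
  exact ⟨p, hp, fun t ht => hpe t (by rw [Set.mem_setOf_eq, lineP_eval]; exact ht)⟩

end LineP2

open MvPolynomial Filter Topology

section CoordAG

variable {n : ℕ} {φ g h : Fin n → (Fin n → ℂ) → ℂ} {H : (Fin n → ℂ) → ℂ}
variable {Q : Fin n → Fin n → Polynomial (MvPolynomial (Fin n) ℂ)} {D : MvPolynomial (Fin n) ℂ}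

lemma base_branch (G : Good φ g h H) {u0 : Fin n → ℂ} (hu : H u0 ≠ 0) :
    ∃ v, Branch g h H v (fun k => φ k u0) ∧ ∀ᶠ u in 𝓝 u0, v (fun k => φ k u) = u := by
  have hf : AnalyticAt ℂ (fun x k => φ k x) u0 := analyticAt_pi_iff.2 (G.an hu)
  obtain ⟨e, he⟩ := fderiv_pi_equiv hf (G.det u0 hu)
  have hanal : AnalyticAt ℂ (he.localInverse (fun x k => φ k x) e u0) (fun k => φ k u0) := by
    refine (he.toOpenPartialHomeomorph _).analyticAt_symm' (i := e) he.mem_toOpenPartialHomeomorph_source ?_ ?_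
    · exact hf
    · exact he.hasFDerivAt.fderiv
  refine ⟨he.localInverse (fun x k => φ k x) e u0, ⟨hanal, ?_, ?_⟩, he.eventually_left_inverse⟩
  all_goals
    have hH : ∀ᶠ y in 𝓝 (fun k => φ k u0), H (he.localInverse (fun x k => φ k x) e u0 y) ≠ 0 :=
      he.localInverse_tendsto.eventually ((G.hH u0).continuousAt.eventually_ne hu)
  · filter_upwards [hH, he.eventually_right_inverse] with y h1 h2 k
    have h3 := congrFun h2 k
    have h4 := G.hk _ h1 k
    rw [G.phi k _ h4, div_eq_iff h4] at h3
    exact h3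
  · exact hH.frequently

lemma base_point (G : Good φ g h H) (hD : D ≠ 0) : ∃ u0, H u0 ≠ 0 ∧ eval (fun k => φ k u0) D ≠ 0 := by
  obtain ⟨u, hu⟩ := G.ne
  have hf : ∃ᶠ y in 𝓝 (fun k => φ k u), eval y D ≠ 0 := by
    intro hc
    exact hD (mvpoly_zero_of_ev D _ (hc.mono fun y hy => not_not.1 hy))
  rw [← nhds_map_of_det (G.an hu) (G.det u hu), frequently_map] at hf
  obtain ⟨v, h1, h2⟩ := (hf.and_eventually ((G.hH u).continuousAt.eventually_ne hu)).exists
  exact ⟨v, h2, h1⟩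

lemma coord_AG (G : Good φ g h H) (np : NoPer φ H) (R : RelData φ H Q D) {u0 : Fin n → ℂ} (hu : H u0 ≠ 0)
    (hD : eval (fun k => φ k u0) D ≠ 0) (i : Fin n) : AG (fun u => u i) φ u0 := by
  obtain ⟨L, hL⟩ := line_poly G np R
  set N := ∏ i, ∏ k, (Q i k).natDegree with hN
  set x0 : Fin n → ℂ := fun k => φ k u0 with hx0
  have hDc : ∀ᶠ y in 𝓝 x0, eval y D ≠ 0 := (MvPolynomial.continuous_eval D).continuousAt.eventually_ne hD
  obtain ⟨ε, hε, hball⟩ := Metric.eventually_nhds_iff_ball.1 hDc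
  let s : Option (Fin n) → Set ℂ := fun o => o.elim Set.univ fun k => Metric.ball (x0 k) ε
  have hbox : ∀ z ∈ Set.pi Set.univ s, (fun k => z (some k)) ∈ Metric.ball x0 ε := by
    intro z hz
    rw [ball_pi _ hε]
    intro k _
    exact hz (some k) (Set.mem_univ _)
  obtain ⟨T, hT⟩ := box_poly s (by
      rintro (_ | k)
      · exact Set.infinite_univ
      · exact infinite_of_mem_nhds (x0 k) (Metric.ball_mem_nhds _ hε)) (max L N)
    (fun z => (eval (fun k => z (some k)) D) ^ N * Pf g h H i (z none) (fun k => z (some k))) (by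
      rintro (_ | k) z hz
      · have hDz := hball _ (hbox z hz)
        obtain ⟨J, w, hJ, hev⟩ := local_PS G np R hDz
        obtain ⟨-, -, hP, -⟩ := hev.self_of_nhds
        refine ⟨Polynomial.C ((eval (fun k => z (some k)) D) ^ N) *
          ∏ M ∈ J, (Polynomial.X - Polynomial.C (w M (fun k => z (some k)) i)), ?_, ?_⟩
        · refine (Polynomial.natDegree_C_mul_le _ _).trans ?_
          rw [Polynomial.natDegree_finsetProd_X_sub_C_eq_card]
          exact hJ.trans (le_max_right _ _)
        · intro t _
          simp only [Function.update_self, ne_eq, reduceCtorEq, not_false_eq_true, Function.update_of_ne]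
          rw [hP i t]
          simp [Polynomial.eval_prod]
      · have hDz := hball _ (hbox z hz)
        obtain ⟨p, hp, hpe⟩ := hL _ k i (z none) hDz
        refine ⟨p, hp.trans (le_max_left _ _), fun t ht => ?_⟩
        have e : (fun k' => Function.update z (some k) t (some k')) = Function.update (fun k => z (some k)) k t := by
          ext k'
          by_cases hk : k' = k
          · subst hk; simp
          · simp [hk]
        have hmem : Function.update z (some k) t ∈ Set.pi Set.univ s := by
          intro o _
          by_cases ho : o = some k
          · subst ho; simpa using ht
          · rw [Function.update_of_ne ho]; exact hz o (Set.mem_univ _)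
        have hb := hball _ (hbox _ hmem)
        rw [e] at hb
        simp only [e]
        rw [← hpe t hb]
        simp)
  have hT' : ∀ x ∈ Metric.ball x0 ε, ∀ l, (eval x D) ^ N * Pf g h H i l x = eval (fun o : Option (Fin n) => o.elim l x) T := by
    intro x hx l
    refine hT (fun o => o.elim l x) ?_
    rintro (_ | k) _
    · exact Set.mem_univ _
    · rw [ball_pi _ hε] at hx
      exact hx k (Set.mem_univ _)
  obtain ⟨J, w, hJ, hev⟩ := local_PS G np R hD
  refine ⟨T, ?_, ?_⟩
  · rintro rfl
    obtain ⟨l, hl⟩ := Infinite.exists_notMem_finset (J.image fun M => w M x0 i)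
    have h1 := hT' x0 (Metric.mem_ball_self hε) l
    rw [map_zero, hev.self_of_nhds.2.2.1 i l] at h1
    refine mul_ne_zero (pow_ne_zero _ hD) (Finset.prod_ne_zero_iff.2 fun M hM h0 => hl ?_) h1
    exact Finset.mem_image.2 ⟨M, hM, (sub_eq_zero.1 h0).symm⟩
  · obtain ⟨v, hv, hvu⟩ := base_branch G hu
    obtain ⟨M, hM, hvM⟩ := hev.self_of_nhds.2.1 v hv
    have key : ∀ᶠ x in 𝓝 x0, eval (fun o : Option (Fin n) => o.elim (v x i) x) T = 0 := by
      filter_upwards [hev, hvM, Metric.ball_mem_nhds x0 hε] with x h1 h2 h3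
      rw [← hT' x h3, h1.2.2.1 i, Finset.prod_eq_zero hM (by rw [h2, sub_self]), mul_zero]
    rw [hx0, ← nhds_map_of_det (G.an hu) (G.det u0 hu), eventually_map] at key
    filter_upwards [key, hvu] with u h1 h2
    rw [h2] at h1
    exact h1

end CoordAG

open MvPolynomial Filter Topology

section Final

variable {n : ℕ} {φ g h : Fin n → (Fin n → ℂ) → ℂ} {H : (Fin n → ℂ) → ℂ}

lemma coord_an (u : Fin n → ℂ) (i : Fin n) : AnalyticAt ℂ (fun u : Fin n → ℂ => u i) u :=
  (ContinuousLinearMap.proj (R := ℂ) (φ := fun _ : Fin n => ℂ) i).analyticAt u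

lemma Qe_coord (Q : Polynomial (MvPolynomial (Fin n) ℂ)) {f : (Fin n → ℂ) → ℂ} {u : Fin n → ℂ}
    (hf : AnalyticAt ℂ f u) : AnalyticAt ℂ (fun x => Qe Q x (f x)) u := by
  have h1 := Qe_analytic (E := Fin n → ℂ) (σ := Fin n) Q (u := u) (θ := fun (i : Fin n) (u : Fin n → ℂ) => u i) (b := f)
    (fun i => coord_an u i) hf
  exact h1

lemma phi_AG (G : Good φ g h H) (np : NoPer φ H) (haat : AdmitsAAT φ) (j : Fin n) :
    ∃ u0, H u0 ≠ 0 ∧ AG (φ j) (fun i u => u i) u0 := by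
  obtain ⟨Q, D, R⟩ := exists_rel G haat
  obtain ⟨u0, hu, hD⟩ := base_point G R.hD
  refine ⟨u0, hu, AG_exchange (G.an hu j) (G.an hu) (coord_an u0) (G.indep hu)
    (gm_indep _ (by exact map_id)) (fun i => coord_AG G np R hu hD i) ?_⟩
  refine ⟨X none - X (some j), ?_, Eventually.of_forall fun x => by simp⟩
  intro h0
  have := X_injective (R := ℂ) (sub_eq_zero.1 h0)
  simp at this

lemma rat_of_noPer (G : Good φ g h H) (np : NoPer φ H) (haat : AdmitsAAT φ) (j : Fin n) : RatFn (φ j) := by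
  obtain ⟨u0, hu0, T, hT0, hT⟩ := phi_AG G np haat j
  obtain ⟨Q, hQ0, hQr⟩ : ∃ Q : Polynomial (MvPolynomial (Fin n) ℂ), Q ≠ 0 ∧
      ∀ x y, Qe Q x y = eval (fun o : Option (Fin n) => o.elim y x) T := by
    refine ⟨optionEquivLeft ℂ (Fin n) T, ?_, fun x y => ?_⟩
    · exact (map_ne_zero_iff _ (optionEquivLeft ℂ (Fin n)).injective).2 hT0
    · rw [Qe_opt, AlgEquiv.symm_apply_apply]
  have hrel : ∀ u, H u ≠ 0 → Qe Q u (φ j u) = 0 := by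
    intro u hu
    refine ent_ident G.hH (F := fun u => Qe Q u (φ j u)) (fun u hu => ?_) hu0 ?_ hu
    · exact Qe_coord Q (G.an hu j)
    · filter_upwards [hT] with x hx
      rw [hQr]
      exact hx
  set a := Q.leadingCoeff with ha
  have ha0 : a ≠ 0 := Polynomial.leadingCoeff_ne_zero.2 hQ0
  obtain ⟨C, M, hC, hCM⟩ := root_bound_all (m := 1) (fun _ _ => Q) a (fun _ _ => dvd_rfl)
  have hb : ∀ u, H u ≠ 0 → ‖eval u a * φ j u‖ ≤ C * (1 + ‖u‖) ^ M := by
    intro u hu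
    rw [norm_mul]
    by_cases h0 : eval u a = 0
    · rw [h0, norm_zero, zero_mul]; positivity
    · exact hCM u h0 0 0 _ (hrel u hu)
  obtain ⟨ε, hε, hball⟩ := Metric.eventually_nhds_iff_ball.1 ((G.hH u0).continuousAt.eventually_ne hu0)
  rw [ball_pi _ hε] at hball
  obtain ⟨P, hP⟩ := box_poly (fun k => Metric.ball (u0 k) ε)
    (fun k => infinite_of_mem_nhds (u0 k) (Metric.ball_mem_nhds _ hε)) M (fun u => eval u a * φ j u) (by
      intro k u hu
      have hupd : ∀ t, AnalyticAt ℂ (fun t => Function.update u k t) t := fun t =>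
        Differentiable.analyticAt (fun t => (upd_deriv u k t).differentiableAt) t
      have hdisc := ent1_disc (F := fun t => H (Function.update u k t))
        (fun t => (G.hH _).fun_comp (hupd t)) ⟨u k, by rw [Function.update_eq_self]; exact hball u hu⟩
      obtain ⟨p, hp, hpe⟩ := poly1 {t | H (Function.update u k t) = 0} (fun t => hdisc t)
        (fun t => eval (Function.update u k t) a * φ j (Function.update u k t))
        (fun t ht => by
          have h1 : DifferentiableAt ℂ (fun t => eval (Function.update u k t) a) t := by
            simp only [← lineP_eval]; exact (lineP a u k).differentiableAt
          exact h1.mul (comp_upd_deriv (G.an ht j).differentiableAt).differentiableAt)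
        (fun t => by
          refine ⟨C * ((1 + ‖u‖) * (2 + ‖t‖)) ^ M, ?_⟩
          filter_upwards [hdisc t, mem_nhdsWithin_of_mem_nhds (Metric.ball_mem_nhds t one_pos)] with s hs hst
          refine (hb _ hs).trans ?_
          have h1 : ‖s‖ ≤ ‖t‖ + 1 := by
            rw [Metric.mem_ball, dist_eq_norm] at hst
            linarith [norm_sub_norm_le s t]
          gcongr
          exact (norm_upd u k s).trans (mul_le_mul_of_nonneg_left (by linarith) (by positivity)))
        M
        (by
          refine ⟨C * ((1 + ‖u‖) * 2) ^ M, ?_⟩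
          filter_upwards [(tendsto_norm_cobounded_atTop (E := ℂ)).eventually_ge_atTop 1] with t ht hs
          refine (hb _ hs).trans ?_
          rw [mul_assoc, ← mul_pow]
          gcongr
          refine (norm_upd u k t).trans ?_
          rw [mul_assoc]
          gcongr
          linarith)
      refine ⟨p, hp, fun t ht => hpe t ?_⟩
      refine hball _ ?_
      intro i _
      by_cases hi : i = k
      · subst hi; simpa using ht
      · rw [Function.update_of_ne hi]; exact hu i (Set.mem_univ _))
  refine ⟨P, a, ha0, Metric.ball u0 ε ∩ {u | eval u a ≠ 0},
    Metric.isOpen_ball.inter (isOpen_ne_fun (MvPolynomial.continuous_eval a) continuous_const), ?_, ?_⟩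
  · by_contra hne
    refine ha0 (mvpoly_zero_of_ev a u0 ?_)
    filter_upwards [Metric.ball_mem_nhds u0 hε] with u hu
    by_contra h0
    exact hne ⟨u, hu, h0⟩
  · rintro u ⟨hu, hau⟩
    rw [ball_pi _ hε] at hu
    rw [eq_div_iff hau, ← hP u hu, mul_comm]

lemma noPer_of (G : Good φ g h H) (j : Fin n)
    (hno : ¬ ∃ p : Fin n → ℂ, p ≠ 0 ∧ ∀ u : Fin n → ℂ, AnalyticAt ℂ (φ j) (u + p) → AnalyticAt ℂ (φ j) u →
        φ j (u + p) = φ j u) : NoPer φ H := by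
  intro p hp
  by_contra hp0
  refine hno ⟨p, hp0, fun u h1 h2 => ?_⟩
  have hadd : ∀ u, AnalyticAt ℂ (fun u : Fin n → ℂ => u + p) u := fun u => analyticAt_id.add analyticAt_const
  have hf : ∃ᶠ x in 𝓝 u, H x ≠ 0 ∧ H (x + p) ≠ 0 := by
    intro hneg
    have := anal_mul_ev (G.hH u) (AnalyticAt.fun_comp (g := H) (f := fun x => x + p) (G.hH (u + p)) (hadd u)) (by
      filter_upwards [hneg] with y hy
      by_contra hc
      exact hy (mul_ne_zero_iff.1 hc))
    rcases this with h1 | h1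
    · exact ent_freq G.hH G.ne u (h1.mono fun y hy => not_not.2 hy)
    · obtain ⟨v, hv⟩ := G.ne
      exact ent_freq (H := fun x => H (x + p)) (fun u => AnalyticAt.fun_comp (g := H) (f := fun x => x + p) (G.hH (u + p)) (hadd u))
        ⟨v - p, by simpa using hv⟩ u (h1.mono fun y hy => not_not.2 hy)
  have hc : ContinuousAt (fun x => φ j (x + p) - φ j x) u :=
    (ContinuousAt.comp (f := fun x => x + p) h1.continuousAt (hadd u).continuousAt).sub h2.continuousAt
  by_contra hne
  obtain ⟨x, hx, hx'⟩ := (hf.and_eventually (hc.eventually_ne (sub_ne_zero.2 hne))).exists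
  exact hx' (sub_eq_zero.2 (hp j x hx.1 hx.2))

end Final

theorem aat_nonrational_is_periodic {n : ℕ} (hn : 1 ≤ n) (φ : Fin n → (Fin n → ℂ) → ℂ)
    (hmero : ∀ k, Mero (φ k)) (hindep : AnalyticallyIndep φ) (haat : AdmitsAAT φ)
    (j : Fin n) (hnotrat : ¬ RatFn (φ j)) :
    ∃ p : Fin n → ℂ, p ≠ 0 ∧
      ∀ u : Fin n → ℂ, AnalyticAt ℂ (φ j) (u + p) → AnalyticAt ℂ (φ j) u →
        φ j (u + p) = φ j u := by
  by_contra hno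
  obtain ⟨g, h, H, G⟩ := exists_good φ hmero hindep
  exact hnotrat (rat_of_noPer G (noPer_of G j hno) haat j)
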